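/- For every real number X there exist real numbers x > X and y > X such that π(x) > Li(x) and π(y) < Li(y); that is, the difference π(x) − Li(x) changes sign infinitely often. -/

import Mathlib

/-- `π(x)`: the number of primes `p ≤ x`. -/
noncomputable def primePi (x : ℝ) : ℕ := Nat.primeCounting ⌊x⌋₊

/-- `Li(x) = ∫₂ˣ dt / log t`. -/
noncomputable def Li (x : ℝ) : ℝ := ∫ t in (2:ℝ)..x, 1 / Real.log t

open scoped Pointwise in
/-- The iterated sumsets of a finite set of an abelian group grow at most polynomially. -/
theorem card_nsmul_le_pow {G : Type*} [AddCommGroup G] [DecidableEq G] (S : Finset G) (n : ℕ) :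
    (n • S).card ≤ (n + 1) ^ S.card := by
  classical
  have hsub : n • S ⊆ (Finset.univ : Finset (S → Fin (n + 1))).image
      (fun c => ∑ s : S, (c s : ℕ) • (s : G)) := by
    induction n with
    | zero =>
      intro x hx
      simp only [zero_nsmul, Finset.mem_zero] at hx
      subst hx
      simp only [Finset.mem_image, Finset.mem_univ, true_and]
      exact ⟨fun _ => 0, by simp⟩
    | succ n ih =>
      intro x hx
      rw [succ_nsmul, Finset.mem_add] at hx
      obtain ⟨y, hy, s, hs, rfl⟩ := hx
      obtain ⟨c, -, rfl⟩ := Finset.mem_image.1 (ih hy)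
      simp only [Finset.mem_image, Finset.mem_univ, true_and]
      refine ⟨fun t => if t = ⟨s, hs⟩ then (c t).succ else (c t).castSucc, ?_⟩
      have : ∀ t : S, ((if t = ⟨s, hs⟩ then (c t).succ else (c t).castSucc : Fin (n + 1 + 1)) : ℕ)
          • (t : G) = (c t : ℕ) • (t : G) + if t = ⟨s, hs⟩ then (t : G) else 0 := by
        intro t
        split_ifs <;> simp [succ_nsmul]
      simp only [this, Finset.sum_add_distrib]
      simp
  calc _ ≤ _ := Finset.card_le_card hsub
    _ ≤ _ := Finset.card_image_le
    _ = _ := by simp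

open scoped Pointwise in
/-- A Følner-type property of finitely generated abelian groups. -/
theorem exists_finset_add_subset_card_le {G : Type*} [AddCommGroup G] [DecidableEq G]
    (S : Finset G) {ε : ℝ} (hε : 0 < ε) :
    ∃ H K : Finset G, H.Nonempty ∧ H ⊆ K ∧ H + S ⊆ K ∧ (K.card : ℝ) ≤ (1 + ε) * H.card := by
  set T := insert 0 S
  by_contra! hcon
  have hne : T.Nonempty := ⟨0, by simp [T]⟩
  have hstep : ∀ n : ℕ, (1 + ε) * (n • T).card < ((n + 1) • T).card := by
    intro n
    refine hcon (n • T) ((n + 1) • T) hne.nsmul ?_ ?_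
    · intro x hx
      rw [succ_nsmul]
      simpa using Finset.add_mem_add hx (Finset.mem_insert_self 0 S)
    · rw [succ_nsmul]
      exact Finset.add_subset_add_left (Finset.subset_insert _ _)
  have hpow : ∀ n : ℕ, (1 + ε) ^ n ≤ ((n • T).card : ℝ) := by
    intro n
    induction n with
    | zero => simp
    | succ n ih =>
      rw [pow_succ, mul_comm]
      exact (mul_le_mul_of_nonneg_left ih (by positivity)).trans (hstep n).le
  have hlim := tendsto_pow_const_div_const_pow_of_one_lt T.card (r := 1 + ε) (by linarith)
  have hlim' := (Filter.tendsto_add_atTop_iff_nat 1).2 hlim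
  have hev := hlim'.eventually (gt_mem_nhds (show (0 : ℝ) < 1 / (1 + ε) by positivity))
  obtain ⟨n, hn⟩ := hev.exists
  rw [div_lt_div_iff₀ (by positivity) (by positivity), pow_succ, one_mul] at hn
  have h1 : ((n • T).card : ℝ) ≤ ((n + 1 : ℕ) : ℝ) ^ T.card := by
    exact_mod_cast card_nsmul_le_pow T n
  have h2 := hpow n
  nlinarith

open scoped Pointwise in
/-- The sum of a summable positive semidefinite function on an abelian group is nonnegative. -/
theorem tsum_nonneg_of_forall_sum_sub_nonneg {G : Type*} [AddCommGroup G] {q : G → ℝ}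
    (hq : Summable q) (hpos : ∀ F : Finset G, 0 ≤ ∑ a ∈ F, ∑ b ∈ F, q (a - b)) :
    0 ≤ ∑' g, q g := by
  classical
  have hqa : Summable (fun g => |q g|) := hq.abs
  set N := ∑' g, |q g|
  have hN : 0 ≤ N := tsum_nonneg fun _ => abs_nonneg _
  suffices h : ∀ ε > 0, 0 ≤ ∑' g, q g + ε * (1 + N) by
    by_contra! hlt
    have := h (-(∑' g, q g) / (2 * (1 + N))) (by apply div_pos <;> linarith)
    field_simp at this
    linarith
  intro ε hε
  obtain ⟨S, hS⟩ := (hq.hasSum.eventually (Metric.ball_mem_nhds _ hε)).exists_forall_of_atTop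
  obtain ⟨H, K, hne, hHK, hadd, hcard⟩ := exists_finset_add_subset_card_le (-S) hε
  have hrow : ∀ a, ∑ b ∈ K, q (a - b) = ∑ g ∈ K.image (fun b => a - b), q g := by
    intro a
    rw [Finset.sum_image (by intro x _ y _ h; simpa using h)]
  have h1 : ∀ a ∈ H, ∑ b ∈ K, q (a - b) ≤ ∑' g, q g + ε := by
    intro a ha
    have hsub : S ≤ K.image (fun b => a - b) := by
      intro s hs
      rw [Finset.mem_image]
      refine ⟨a + -s, hadd (Finset.add_mem_add ha (Finset.neg_mem_neg hs)), by abel⟩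
    have := hS _ hsub
    rw [← hrow, Real.dist_eq, abs_lt] at this
    linarith
  have h2 : ∀ a ∈ K \ H, ∑ b ∈ K, q (a - b) ≤ N := by
    intro a _
    rw [hrow]
    exact (Finset.sum_le_sum fun _ _ => le_abs_self _).trans
      (hqa.sum_le_tsum _ fun _ _ => abs_nonneg _)
  have h3 := hpos K
  rw [← Finset.sum_sdiff hHK] at h3
  have h4 := Finset.sum_le_card_nsmul _ _ _ h1
  have h5 := Finset.sum_le_card_nsmul _ _ _ h2
  have h6 : ((K \ H).card : ℝ) ≤ ε * H.card := by
    rw [Finset.card_sdiff_of_subset hHK, Nat.cast_sub (Finset.card_le_card hHK)]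
    linarith
  rw [nsmul_eq_mul] at h4 h5
  have hH : (0 : ℝ) < H.card := by exact_mod_cast hne.card_pos
  have h7 : ((K \ H).card : ℝ) * N ≤ ε * H.card * N := mul_le_mul_of_nonneg_right h6 hN
  have : 0 ≤ (H.card : ℝ) * (∑' g, q g + ε * (1 + N)) := by nlinarith
  exact nonneg_of_mul_nonneg_right this hH

/-- The Cauchy-type matrix `1 / (x + i (a - b))` is positive semidefinite. -/
theorem re_sum_sum_div_nonneg {x : ℝ} (hx : 0 < x) (F : Finset ℝ) (z : ℝ → ℂ) :
    0 ≤ (∑ a ∈ F, ∑ b ∈ F, z a * (starRingEnd ℂ) (z b) *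
      ((x : ℂ) / (x + (a - b : ℝ) * Complex.I))).re := by
  have hInt : ∀ a b : ℝ, MeasureTheory.IntegrableOn
      (fun v : ℝ => Complex.exp (-(x + (a - b : ℝ) * Complex.I) * v)) (Set.Ioi 0) := by
    intro a b
    exact integrableOn_exp_mul_complex_Ioi (by simpa using hx) 0
  have hval : ∀ a b : ℝ, (1 : ℂ) / (x + (a - b : ℝ) * Complex.I) =
      ∫ v : ℝ in Set.Ioi 0, Complex.exp (-(x + (a - b : ℝ) * Complex.I) * v) := by
    intro a b
    rw [integral_exp_mul_complex_Ioi (by simpa using hx) 0]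
    simp only [Complex.ofReal_zero, mul_zero, Complex.exp_zero]
    rw [neg_div_neg_eq]
  have hsum : (∑ a ∈ F, ∑ b ∈ F, z a * (starRingEnd ℂ) (z b) *
      ((x : ℂ) / (x + (a - b : ℝ) * Complex.I))) = ∫ v : ℝ in Set.Ioi 0,
        ∑ a ∈ F, ∑ b ∈ F, z a * (starRingEnd ℂ) (z b) * x *
          Complex.exp (-(x + (a - b : ℝ) * Complex.I) * v) := by
    rw [MeasureTheory.integral_finsetSum]
    · refine Finset.sum_congr rfl fun a _ => ?_
      rw [MeasureTheory.integral_finsetSum]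
      · refine Finset.sum_congr rfl fun b _ => ?_
        rw [MeasureTheory.integral_const_mul, ← hval]
        ring
      · intro b _
        exact (hInt a b).const_mul _
    · intro a _
      exact MeasureTheory.integrable_finsetSum _ fun b _ => (hInt a b).const_mul _
  have hpt : ∀ v : ℝ, (∑ a ∈ F, ∑ b ∈ F, z a * (starRingEnd ℂ) (z b) * x *
          Complex.exp (-(x + (a - b : ℝ) * Complex.I) * v)) =
      ((x * Real.exp (-x * v) * Complex.normSq (∑ a ∈ F, z a * Complex.exp (-(a * v) * Complex.I)) : ℝ) : ℂ) := by
    intro v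
    push_cast
    rw [← Complex.mul_conj, map_sum, Finset.sum_mul_sum, Finset.mul_sum]
    refine Finset.sum_congr rfl fun a _ => ?_
    rw [Finset.mul_sum]
    refine Finset.sum_congr rfl fun b _ => ?_
    rw [map_mul, ← Complex.exp_conj]
    have : Complex.exp (-(x + ((a : ℂ) - b) * Complex.I) * v) = Complex.exp (-x * v) *
        (Complex.exp (-(a * v) * Complex.I) *
          Complex.exp ((starRingEnd ℂ) (-(b * v) * Complex.I))) := by
      rw [← Complex.exp_add, ← Complex.exp_add]
      congr 1
      simp
      ring
    rw [this]
    ring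
  rw [hsum]
  simp_rw [hpt]
  rw [integral_complex_ofReal, Complex.ofReal_re]
  refine MeasureTheory.integral_nonneg fun v => ?_
  have := Complex.normSq_nonneg (∑ a ∈ F, z a * Complex.exp (-(a * v) * Complex.I))
  positivity

open Complex Metric Set Filter Topology in
/-- A nonvanishing holomorphic function on a disc is the exponential of a holomorphic function. -/
theorem exists_differentiableOn_eq_mul_exp {g : ℂ → ℂ} {R : ℝ} (hR : 0 < R)
    (hg : DifferentiableOn ℂ g (ball 0 R)) (hg0 : ∀ w ∈ ball 0 R, g w ≠ 0) :
    ∃ Q : ℂ → ℂ, DifferentiableOn ℂ Q (ball 0 R) ∧ Q 0 = 0 ∧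
      ∀ w ∈ ball 0 R, g w = g 0 * exp (Q w) := by
  have hdq : DifferentiableOn ℂ (fun w => deriv g w / g w) (ball 0 R) :=
    (hg.deriv isOpen_ball).div hg hg0
  obtain ⟨F, hF⟩ := hdq.isExactOn_ball
  have h0 : (0 : ℂ) ∈ ball 0 R := mem_ball_self hR
  refine ⟨fun w => F w - F 0, fun w hw => ((hF w hw).differentiableAt.sub_const _).differentiableWithinAt,
    by simp, fun w hw => ?_⟩
  have hder : ∀ z ∈ ball (0 : ℂ) R, HasDerivAt (fun z => g z * exp (-(F z - F 0))) 0 z := by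
    intro z hz
    have h1 := (hg.differentiableAt (isOpen_ball.mem_nhds hz)).hasDerivAt
    have h2 := ((hF z hz).sub_const (F 0)).neg.cexp
    convert! h1.mul h2 using 1
    have := hg0 z hz
    simp only [Pi.neg_apply]
    field_simp
    ring
  have hconst := isOpen_ball.is_const_of_deriv_eq_zero (convex_ball (0 : ℂ) R).isPreconnected
    (fun z hz => (hder z hz).differentiableAt.differentiableWithinAt)
    (fun z hz => (hder z hz).deriv) hw h0
  simp only [sub_self, neg_zero, exp_zero, mul_one] at hconst
  rw [← hconst, mul_assoc, ← exp_add]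
  simp

open Complex Metric Set Filter Topology in
/-- Finitely many zeros of an entire function can be divided out. -/
theorem exists_differentiable_eq_prod_mul {f : ℂ → ℂ} (hf : Differentiable ℂ f) (hf0 : f 0 ≠ 0)
    (S : Finset ℂ) (hS : ∀ a ∈ S, a ≠ 0) :
    ∃ g : ℂ → ℂ, Differentiable ℂ g ∧
      (∀ w, f w = (∏ a ∈ S, (1 - w / a) ^ analyticOrderNatAt f a) * g w) ∧
      ∀ a ∈ S, g a ≠ 0 := by
  classical
  induction S using Finset.induction_on with
  | empty => exact ⟨f, hf, by simp, by simp⟩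
  | insert a S ha ih =>
    obtain ⟨g, hg, hfg, hgS⟩ := ih fun b hb => hS b (Finset.mem_insert_of_mem hb)
    have ha0 : a ≠ 0 := hS a (Finset.mem_insert_self _ _)
    have hfa : AnalyticAt ℂ f a := hf.analyticAt a
    have htop : analyticOrderAt f a ≠ ⊤ := by
      intro h
      rw [analyticOrderAt_eq_top] at h
      have han : AnalyticOnNhd ℂ f univ := fun z _ => hf.analyticAt z
      exact hf0 (han.eqOn_zero_of_preconnected_of_eventuallyEq_zero
        isPreconnected_univ (mem_univ a) h (mem_univ 0))
    obtain ⟨h, hh, hha, hfh⟩ := hfa.analyticOrderAt_ne_top.1 htop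
    set n := analyticOrderNatAt f a
    set P : ℂ → ℂ := fun w => ∏ b ∈ S, (1 - w / b) ^ analyticOrderNatAt f b with hP
    have hPd : Differentiable ℂ P := by
      rw [hP]; fun_prop
    have hPa : P a ≠ 0 := by
      rw [hP]
      refine Finset.prod_ne_zero_iff.2 fun b hb => pow_ne_zero _ ?_
      have hb0 := hS b (Finset.mem_insert_of_mem hb)
      rw [sub_ne_zero, ne_comm, Ne, div_eq_one_iff_eq hb0]
      rintro rfl
      exact ha hb
    set k : ℂ → ℂ := fun w => (-a) ^ n * h w / P w with hk
    have hka : DifferentiableAt ℂ k a :=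
      (hh.differentiableAt.const_mul _).div (hPd a) hPa
    have hevP : ∀ᶠ w in 𝓝 a, P w ≠ 0 := hPd.continuous.continuousAt.eventually_ne hPa
    have hlin : ∀ w, (w - a) = (-a) * (1 - w / a) := by
      intro w; field_simp; ring
    have hne : ∀ w, w ≠ a → (1 - w / a) ≠ 0 := by
      intro w hw h0
      apply hw
      have := hlin w
      rw [h0, mul_zero, sub_eq_zero] at this
      exact this
    have hloc : ∀ᶠ w in 𝓝 a, w ≠ a → g w / (1 - w / a) ^ n = k w := by
      filter_upwards [hfh, hevP] with w hw hPw hwa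
      have h1 := hfg w
      rw [hw, smul_eq_mul, hlin w, mul_pow] at h1
      have h2 := hne w hwa
      rw [hk, div_eq_div_iff (pow_ne_zero _ h2) hPw]
      linear_combination -h1
    refine ⟨Function.update (fun w => g w / (1 - w / a) ^ n) a (k a), ?_, ?_, ?_⟩
    · intro w
      rcases eq_or_ne w a with rfl | hw
      · refine hka.congr_of_eventuallyEq ?_
        filter_upwards [hloc] with z hz
        rcases eq_or_ne z w with rfl | hzw
        · simp
        · simp [Function.update_of_ne hzw, hz hzw]
      · have : DifferentiableAt ℂ (fun w => g w / (1 - w / a) ^ n) w :=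
          (hg w).div (by fun_prop) (pow_ne_zero _ (hne w hw))
        refine this.congr_of_eventuallyEq ?_
        filter_upwards [isOpen_ne.mem_nhds hw] with z hz
        simp [Function.update_of_ne hz]
    · intro w
      rw [Finset.prod_insert ha]
      rcases eq_or_ne w a with rfl | hw
      · simp only [Function.update_self, hk]
        have h3 : f w = (w - w) ^ n • h w := hfh.self_of_nhds
        rw [hlin w, mul_pow, smul_eq_mul] at h3
        change f w = (_ * P w) * _
        rw [h3]
        simp only [n]
        field_simp
      · have := hne w hw
        rw [Function.update_of_ne hw, hfg w]
        simp only [n]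
        field_simp
    · intro b hb
      rcases eq_or_ne b a with rfl | hba
      · simp only [Function.update_self, hk]
        exact div_ne_zero (mul_ne_zero (pow_ne_zero _ (neg_ne_zero.2 ha0)) hha) hPa
      · rw [Function.update_of_ne hba]
        exact div_ne_zero (hgS b (Finset.mem_of_mem_insert_of_ne hb hba)) (pow_ne_zero _ (hne b hba))

open Complex Metric Set Filter Topology in
theorem finite_setOf_norm_le_and_eq_zero {f : ℂ → ℂ} (hf : Differentiable ℂ f) (hf0 : f 0 ≠ 0)
    (R : ℝ) : {w : ℂ | ‖w‖ ≤ R ∧ f w = 0}.Finite := by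
  by_contra hinf
  obtain ⟨a, -, ha⟩ := Set.Infinite.exists_accPt_of_subset_isCompact hinf
    (isCompact_closedBall (0 : ℂ) R) (fun w hw => by simpa using hw.1)
  have hfreq : ∃ᶠ w in 𝓝[≠] a, f w = 0 :=
    (accPt_iff_frequently_nhdsNE.1 ha).mono fun w hw => hw.2
  have han : AnalyticOnNhd ℂ f univ := fun z _ => hf.analyticAt z
  exact hf0 (han.eqOn_zero_of_preconnected_of_frequently_eq_zero
    isPreconnected_univ (mem_univ a) hfreq (mem_univ 0))

open Complex Metric Set Filter Topology in
/-- Quantitative comparison, on the real axis, of an even entire function whose zeros are purely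
imaginary with the product over its zeros of modulus at most `R`. -/
theorem abs_log_norm_sub_sum_le {Φ : ℂ → ℂ} (hΦ : Differentiable ℂ Φ) (hΦ0 : Φ 0 ≠ 0)
    (heven : ∀ w, Φ (-w) = Φ w) (hzero : ∀ w, Φ w = 0 → w.re = 0) {R M x : ℝ}
    (hM : ∀ w : ℂ, ‖w‖ = 2 * R → ‖Φ w‖ ≤ Real.exp M) (hxR : 2 * |x| < R) (hx : x ≠ 0)
    {S : Finset ℝ} (hS : ∀ γ : ℝ, γ ∈ S ↔ |γ| ≤ R ∧ Φ (γ * I) = 0) :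
    |Real.log ‖Φ x‖ - Real.log ‖Φ 0‖ - ∑ γ ∈ S, (analyticOrderNatAt Φ (γ * I) : ℝ) *
      (Real.log (1 + x ^ 2 / γ ^ 2) / 2)| ≤
      8 * (|M| + |Real.log ‖Φ 0‖| + 1) * x ^ 2 / R ^ 2 := by
  classical
  have hR : 0 < R := by linarith [abs_nonneg x]
  have hS0 : ∀ γ ∈ S, γ ≠ 0 := by
    rintro γ hγ rfl
    have := ((hS 0).1 hγ).2
    simp at this
    exact hΦ0 this
  set T : Finset ℂ := S.image fun γ : ℝ => (γ : ℂ) * I with hT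
  have hinj : Function.Injective fun γ : ℝ => (γ : ℂ) * I := by
    intro a b hab
    simpa using hab
  obtain ⟨g, hg, hfg, hgT⟩ := exists_differentiable_eq_prod_mul hΦ hΦ0 T (by
    intro a ha
    obtain ⟨γ, hγ, rfl⟩ := Finset.mem_image.1 ha
    simpa using hS0 γ hγ)
  have hprod : ∀ w, Φ w = (∏ γ ∈ S, (1 - w / (γ * I)) ^ analyticOrderNatAt Φ (γ * I)) * g w := by
    intro w
    rw [hfg w, hT, Finset.prod_image hinj.injOn]
  have hg0 : g 0 = Φ 0 := by rw [hprod 0]; simp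
  have hgbd : ∀ w : ℂ, ‖w‖ ≤ 2 * R → ‖g w‖ ≤ Real.exp M := by
    intro w hw
    refine norm_le_of_forall_mem_frontier_norm_le (U := ball 0 (2 * R)) isBounded_ball
      hg.diffContOnCl ?_ ?_
    · intro z hz
      rw [frontier_ball _ (by positivity)] at hz
      have hz' : ‖z‖ = 2 * R := by simpa using hz
      have h1 := hM z hz'
      rw [hprod z, norm_mul] at h1
      refine le_trans (le_mul_of_one_le_left (norm_nonneg _) ?_) h1
      rw [norm_prod]
      refine Finset.one_le_prod (fun γ hγ => ?_)
      rw [norm_pow]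
      refine one_le_pow₀ ?_
      have h2 : 2 ≤ ‖z / (γ * I)‖ := by
        rw [norm_div, norm_mul, norm_I, mul_one, norm_real, Real.norm_eq_abs, hz',
          le_div_iff₀ (abs_pos.2 (hS0 γ hγ))]
        linarith [((hS γ).1 hγ).1]
      have h3 := norm_sub_norm_le (z / (γ * I)) 1
      rw [norm_one, norm_sub_rev] at h3
      linarith
    · rw [closure_ball _ (by positivity)]
      simpa using hw
  have hgne : ∀ w ∈ ball (0 : ℂ) R, g w ≠ 0 := by
    intro w hw h0
    have hΦw : Φ w = 0 := by rw [hprod w, h0, mul_zero]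
    have hre := hzero w hΦw
    have hwI : w = (w.im : ℂ) * I := by
      apply Complex.ext <;> simp [hre]
    have hmem : w.im ∈ S := by
      rw [hS, ← hwI]
      refine ⟨(abs_im_le_norm w).trans ?_, hΦw⟩
      have : ‖w‖ < R := by simpa using hw
      exact this.le
    exact hgT w (Finset.mem_image.2 ⟨_, hmem, hwI.symm⟩) h0
  obtain ⟨Q, hQ, hQ0, hgQ⟩ := exists_differentiableOn_eq_mul_exp hR hg.differentiableOn hgne
  have hlog : ∀ w ∈ ball (0 : ℂ) R, Real.log ‖g w‖ = Real.log ‖Φ 0‖ + (Q w).re := by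
    intro w hw
    rw [hgQ w hw, hg0, norm_mul, norm_exp, Real.log_mul (norm_ne_zero_iff.2 hΦ0)
      (Real.exp_ne_zero _), Real.log_exp]
  set N := |M| + |Real.log ‖Φ 0‖| + 1 with hN
  have hNpos : 0 < N := by positivity
  have hmaps : MapsTo Q (ball 0 R) {z | z.re ≤ N} := by
    intro w hw
    have hw' : ‖w‖ < R := by simpa using hw
    have h1 := hgbd w (by linarith)
    have h2 := Real.log_le_log (norm_pos_iff.2 (hgne w hw)) h1
    rw [hlog w hw, Real.log_exp] at h2
    have h3 := le_abs_self M
    have h4 := neg_abs_le (Real.log ‖Φ 0‖)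
    change (Q w).re ≤ N
    linarith
  have hQbd : ∀ w ∈ ball (0 : ℂ) (R / 2), ‖Q w‖ ≤ 2 * N := by
    intro w hw
    have hw' : ‖w‖ < R / 2 := by simpa using hw
    have h1 := borelCaratheodory_zero hNpos hQ hmaps hR (z := w)
      (by simp; linarith) hQ0
    refine h1.trans ?_
    rw [div_le_iff₀ (by linarith)]
    nlinarith
  set F : ℂ → ℂ := fun w => Q w + Q (-w) with hF
  have hQ' : DifferentiableOn ℂ Q (ball 0 (R / 2)) :=
    hQ.mono (ball_subset_ball (by linarith))
  have hFd : DifferentiableOn ℂ F (ball 0 (R / 2)) := by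
    refine hQ'.add (hQ'.comp differentiable_neg.differentiableOn ?_)
    intro w hw
    simpa using hw
  have hF0 : F 0 = 0 := by simp [hF, hQ0]
  have hFmaps : MapsTo F (ball 0 (R / 2)) (closedBall (F 0) (4 * N)) := by
    intro w hw
    rw [hF0, mem_closedBall_zero_iff]
    refine (norm_add_le _ _).trans ?_
    have h1 := hQbd w hw
    have h2 := hQbd (-w) (by simpa using hw)
    linarith
  have hFo : (F · - F 0) =o[𝓝 0] (fun w : ℂ => ‖w - 0‖ ^ 1) := by
    have hQat : HasDerivAt Q (deriv Q 0) 0 :=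
      (hQ.differentiableAt (isOpen_ball.mem_nhds (mem_ball_self hR))).hasDerivAt
    have hQat' : HasDerivAt Q (deriv Q 0) (-0) := by simpa using hQat
    have hFat : HasDerivAt F 0 0 := by
      have h1 := hQat.add (hQat'.comp (0 : ℂ) (hasDerivAt_neg (0 : ℂ)))
      convert! h1 using 1
      ring
    have := hFat.isLittleO
    simp only [smul_zero, sub_zero] at this ⊢
    refine this.trans_isBigO ?_
    simp only [pow_one]
    exact (Asymptotics.isBigO_refl _ _).norm_right
  have hxball : (x : ℂ) ∈ ball (0 : ℂ) (R / 2) := by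
    simp; linarith
  have hschwarz := dist_le_mul_div_pow_of_mapsTo_ball_of_isLittleO hFd hFmaps hFo hxball
  rw [hF0, dist_zero_right, dist_zero_right, norm_real, Real.norm_eq_abs] at hschwarz
  have hxR' : (x : ℂ) ∈ ball (0 : ℂ) R := ball_subset_ball (by linarith) hxball
  have hnxR' : (-x : ℂ) ∈ ball (0 : ℂ) R := by simpa using hxR'
  have hfac : ∀ (y : ℝ), y ^ 2 = x ^ 2 → ∀ γ ∈ S,
      ‖1 - (y : ℂ) / (γ * I)‖ ^ 2 = 1 + x ^ 2 / γ ^ 2 := by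
    intro y hy γ hγ
    have h1 : (1 - (y : ℂ) / (γ * I)) = ((1 : ℝ) : ℂ) + ((y / γ : ℝ) : ℂ) * I := by
      have := hS0 γ hγ
      have h2 : (γ : ℂ) ≠ 0 := by exact_mod_cast this
      push_cast
      field_simp
      linear_combination -(y : ℂ) * I_sq
    rw [h1, ← normSq_eq_norm_sq, normSq_add_mul_I, div_pow, hy]
    ring
  have hmain : ∀ (y : ℝ), y ^ 2 = x ^ 2 → (y : ℂ) ∈ ball (0 : ℂ) R →
      Real.log ‖Φ y‖ = ∑ γ ∈ S, (analyticOrderNatAt Φ (γ * I) : ℝ) *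
        (Real.log (1 + x ^ 2 / γ ^ 2) / 2) + (Real.log ‖Φ 0‖ + (Q y).re) := by
    intro y hy hyR
    have hfpos : ∀ γ ∈ S, ‖1 - (y : ℂ) / (γ * I)‖ ≠ 0 := by
      intro γ hγ h0
      have := hfac y hy γ hγ
      rw [h0] at this
      have h2 : 0 ≤ x ^ 2 / γ ^ 2 := by positivity
      linarith
    rw [← hlog _ hyR, hprod y, norm_mul, norm_prod, Real.log_mul, Real.log_prod]
    · congr 1
      refine Finset.sum_congr rfl fun γ hγ => ?_
      rw [norm_pow, Real.log_pow, ← hfac y hy γ hγ, Real.log_pow]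
      push_cast
      ring
    · intro γ hγ
      rw [norm_pow]
      exact pow_ne_zero _ (hfpos γ hγ)
    · refine Finset.prod_ne_zero_iff.2 fun γ hγ => ?_
      rw [norm_pow]
      exact pow_ne_zero _ (hfpos γ hγ)
    · exact norm_ne_zero_iff.2 (hgne _ hyR)
  have e1 := hmain x rfl hxR'
  have e2 := hmain (-x) (by ring) (by simpa using hxR')
  rw [ofReal_neg, heven] at e2
  have e3 : (F x).re = (Q x).re + (Q (-x)).re := by simp [hF]
  have e4 : Real.log ‖Φ x‖ - Real.log ‖Φ 0‖ - ∑ γ ∈ S, (analyticOrderNatAt Φ (γ * I) : ℝ) *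
      (Real.log (1 + x ^ 2 / γ ^ 2) / 2) = (F x).re / 2 := by linarith
  rw [e4, abs_div, abs_two]
  have e5 := (abs_re_le_norm (F x)).trans hschwarz
  have e6 : 4 * N * (|x| / (R / 2)) ^ (1 + 1) = 2 * (8 * N * x ^ 2 / R ^ 2) := by
    rw [← sq_abs x, show |x| / (R / 2) = 2 * |x| / R by field_simp, div_pow]
    ring
  rw [e6] at e5
  linarith

open Complex Metric Set Filter Topology in
/-- Hadamard factorization on the real axis for an even entire function of order less than two with
purely imaginary zeros. -/
theorem exists_tendsto_sum_log_one_add_sq_div {Φ : ℂ → ℂ} (hΦ : Differentiable ℂ Φ)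
    (hΦ0 : Φ 0 ≠ 0) (heven : ∀ w, Φ (-w) = Φ w) (hzero : ∀ w, Φ w = 0 → w.re = 0) {M : ℝ → ℝ}
    (hM : ∀ w : ℂ, ‖Φ w‖ ≤ Real.exp (M ‖w‖)) (hMo : M =o[atTop] fun r : ℝ => r ^ 2) :
    ∃ S : ℝ → Finset ℝ, (∀ R γ, γ ∈ S R ↔ |γ| ≤ R ∧ Φ (γ * I) = 0) ∧
      ∀ x : ℝ, x ≠ 0 → Tendsto (fun R => ∑ γ ∈ S R, (analyticOrderNatAt Φ (γ * I) : ℝ) *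
        (Real.log (1 + x ^ 2 / γ ^ 2) / 2)) atTop (𝓝 (Real.log ‖Φ x‖ - Real.log ‖Φ 0‖)) := by
  have hfin : ∀ R : ℝ, {γ : ℝ | |γ| ≤ R ∧ Φ (γ * I) = 0}.Finite := by
    intro R
    have hinj : Function.Injective fun γ : ℝ => (γ : ℂ) * I := by
      intro a b hab
      simpa using hab
    refine Set.Finite.of_finite_image ((finite_setOf_norm_le_and_eq_zero hΦ hΦ0 R).subset ?_)
      hinj.injOn
    rintro _ ⟨γ, hγ, rfl⟩
    exact ⟨by simpa using hγ.1, hγ.2⟩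
  refine ⟨fun R => (hfin R).toFinset, fun R γ => by simp, fun x hx => ?_⟩
  rw [tendsto_iff_dist_tendsto_zero]
  have hbound : Tendsto (fun R : ℝ => 8 * (|M (2 * R)| + |Real.log ‖Φ 0‖| + 1) * x ^ 2 / R ^ 2)
      atTop (𝓝 0) := by
    have htwoR : Tendsto (fun R : ℝ => 2 * R) atTop atTop :=
      tendsto_id.const_mul_atTop (by norm_num)
    have h1 : Tendsto (fun R : ℝ => |M (2 * R) / (2 * R) ^ 2|) atTop (𝓝 0) := by
      simpa using (hMo.tendsto_div_nhds_zero.comp htwoR).abs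
    have h2 : Tendsto (fun R : ℝ => (R ^ 2)⁻¹) atTop (𝓝 0) :=
      (tendsto_pow_atTop two_ne_zero).inv_tendsto_atTop
    have h3 := (h1.const_mul (32 * x ^ 2)).add (h2.const_mul (8 * (|Real.log ‖Φ 0‖| + 1) * x ^ 2))
    simp only [mul_zero, add_zero] at h3
    refine h3.congr' ?_
    filter_upwards [eventually_gt_atTop 0] with R hR
    rw [abs_div, abs_of_pos (show (0 : ℝ) < (2 * R) ^ 2 by positivity)]
    field_simp
    ring
  refine squeeze_zero' (Eventually.of_forall fun _ => dist_nonneg) ?_ hbound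
  filter_upwards [eventually_gt_atTop (2 * |x|)] with R hR
  rw [dist_comm, Real.dist_eq]
  exact abs_log_norm_sub_sum_le hΦ hΦ0 heven hzero (fun w hw => hw ▸ hM w) hR hx
    (fun γ => by simp)

open Complex Set Filter Topology in
/-- An even entire function of order less than two with purely imaginary zeros whose zeros carry a
positive definite weight grows at most exponentially on the positive real axis. -/
theorem exists_log_norm_le_of_forall_sum_sub_nonneg {Φ : ℂ → ℂ} (hΦ : Differentiable ℂ Φ)
    (hΦ0 : Φ 0 ≠ 0) (heven : ∀ w, Φ (-w) = Φ w) (hzero : ∀ w, Φ w = 0 → w.re = 0) {M : ℝ → ℝ}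
    (hM : ∀ w : ℂ, ‖Φ w‖ ≤ Real.exp (M ‖w‖)) (hMo : M =o[atTop] fun r : ℝ => r ^ 2)
    {r : ℝ → ℂ} (hr0 : r 0 = 1)
    (hr : ∀ γ : ℝ, γ ≠ 0 → r γ = analyticOrderNatAt Φ (γ * I) / (1 / 2 + γ * I))
    (hpos : ∀ F : Finset ℝ, ∀ x : ℝ, 0 < x →
      0 ≤ (∑ a ∈ F, ∑ b ∈ F, r (a - b) * ((x : ℂ) / (x + (a - b : ℝ) * I))).re) :
    ∃ C : ℝ, ∀ x : ℝ, 1 ≤ x → Real.log ‖Φ x‖ ≤ Real.log ‖Φ 1‖ + C * (x - 1) := by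
  classical
  obtain ⟨S, hS, hlim⟩ := exists_tendsto_sum_log_one_add_sq_div hΦ hΦ0 heven hzero hM hMo
  set m : ℝ → ℝ := fun γ => (analyticOrderNatAt Φ (γ * I) : ℝ) with hm
  have hm_nonneg : ∀ γ, 0 ≤ m γ := fun γ => Nat.cast_nonneg _
  have hm_zero : ∀ γ : ℝ, Φ (γ * I) ≠ 0 → m γ = 0 := by
    intro γ h
    have : analyticOrderAt Φ (γ * I) = 0 := (hΦ.analyticAt _).analyticOrderAt_eq_zero.2 h
    simp [hm, analyticOrderNatAt, this]
  have hm0 : m 0 = 0 := hm_zero 0 (by simpa using hΦ0)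
  have hlog_nonneg : ∀ x γ : ℝ, 0 ≤ Real.log (1 + x ^ 2 / γ ^ 2) / 2 := by
    intro x γ
    have : 0 ≤ x ^ 2 / γ ^ 2 := by positivity
    have := Real.log_nonneg (show (1 : ℝ) ≤ 1 + x ^ 2 / γ ^ 2 by linarith)
    linarith
  have hsumle : ∀ F : Finset ℝ, ∑ γ ∈ F, m γ / (1 / 4 + γ ^ 2) ≤
      8 * (Real.log ‖Φ 1‖ - Real.log ‖Φ 0‖) := by
    intro F
    have hl := (hlim 1 one_ne_zero).const_mul 8
    rw [ofReal_one] at hl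
    refine ge_of_tendsto hl ?_
    obtain ⟨R₀, hR₀⟩ : ∃ R₀ : ℝ, ∀ γ ∈ F, |γ| ≤ R₀ :=
      ⟨∑ γ ∈ F, |γ|, fun γ hγ => Finset.single_le_sum (f := fun γ => |γ|)
        (fun _ _ => abs_nonneg _) hγ⟩
    filter_upwards [eventually_ge_atTop R₀] with R hR
    have h1 : ∑ γ ∈ F, m γ / (1 / 4 + γ ^ 2) =
        ∑ γ ∈ F.filter (fun γ : ℝ => Φ (γ * I) = 0), m γ / (1 / 4 + γ ^ 2) := by
      rw [Finset.sum_filter_of_ne]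
      intro γ _ h
      by_contra hne
      exact h (by rw [hm_zero γ hne, zero_div])
    rw [h1, Finset.mul_sum]
    refine le_trans (Finset.sum_le_sum_of_subset_of_nonneg (t := S R) ?_ ?_)
      (Finset.sum_le_sum ?_)
    · intro γ hγ
      rw [Finset.mem_filter] at hγ
      exact (hS R γ).2 ⟨(hR₀ γ hγ.1).trans hR, hγ.2⟩
    · intro γ _ _
      have := hm_nonneg γ
      positivity
    · intro γ hγ
      have hγ0 : γ ≠ 0 := by
        rintro rfl
        have := ((hS R 0).1 hγ).2
        simp at this
        exact hΦ0 this
      have hγ2 : 0 < γ ^ 2 := by positivity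
      have h2 := Real.one_sub_inv_le_log_of_pos (show 0 < 1 + 1 ^ 2 / γ ^ 2 by positivity)
      have h3 : 1 / (1 / 4 + γ ^ 2) ≤ 4 * (1 - (1 + 1 ^ 2 / γ ^ 2)⁻¹) := by
        have : 4 * (1 - (1 + 1 ^ 2 / γ ^ 2)⁻¹) = 4 / (1 + γ ^ 2) := by
          field_simp
          ring
        rw [this, div_le_div_iff₀ (by positivity) (by positivity)]
        nlinarith
      rw [div_eq_mul_one_div, mul_left_comm]
      refine mul_le_mul_of_nonneg_left ?_ (hm_nonneg γ)
      linarith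
  have hsum : Summable fun γ => m γ / (1 / 4 + γ ^ 2) :=
    summable_of_sum_le (fun γ => by have := hm_nonneg γ; positivity) hsumle
  set W := ∑' γ, m γ / (1 / 4 + γ ^ 2) with hW
  have hbound : ∀ x : ℝ, 1 ≤ x → ∀ F : Finset ℝ, ∑ γ ∈ F, m γ * (x / (x ^ 2 + γ ^ 2)) ≤ 1 + W := by
    intro x hx F
    set k : ℝ → ℝ := fun γ => x * (x / 2 - γ ^ 2) / ((1 / 4 + γ ^ 2) * (x ^ 2 + γ ^ 2)) with hk
    have hxs : Summable fun γ => m γ * (x / (x ^ 2 + γ ^ 2)) := by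
      refine Summable.of_nonneg_of_le (fun γ => by have := hm_nonneg γ; positivity) (fun γ => ?_)
        (hsum.mul_left x)
      rw [mul_div_left_comm]
      refine mul_le_mul_of_nonneg_left ?_ (by linarith)
      refine div_le_div_of_nonneg_left (hm_nonneg γ) (by positivity) (by nlinarith)
    have hkle : ∀ γ, m γ * k γ ≤ m γ / (1 / 4 + γ ^ 2) - m γ * (x / (x ^ 2 + γ ^ 2)) := by
      intro γ
      rw [div_eq_mul_one_div, ← mul_sub]
      refine mul_le_mul_of_nonneg_left ?_ (hm_nonneg γ)
      rw [hk, div_sub_div _ _ (by positivity) (by positivity)]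
      refine div_le_div_of_nonneg_right ?_ (by positivity)
      nlinarith [sq_nonneg γ]
    have hkabs : ∀ γ, ‖m γ * k γ‖ ≤ m γ / (1 / 4 + γ ^ 2) + m γ * (x / (x ^ 2 + γ ^ 2)) := by
      intro γ
      rw [Real.norm_eq_abs, abs_mul, abs_of_nonneg (hm_nonneg γ), div_eq_mul_one_div, ← mul_add]
      refine mul_le_mul_of_nonneg_left ?_ (hm_nonneg γ)
      rw [hk, div_add_div _ _ (by positivity) (by positivity), abs_div,
        abs_of_pos (show 0 < (1 / 4 + γ ^ 2) * (x ^ 2 + γ ^ 2) by positivity)]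
      refine div_le_div_of_nonneg_right ?_ (by positivity)
      rw [abs_le]
      constructor <;> nlinarith [sq_nonneg γ]
    have hks : Summable fun γ => m γ * k γ :=
      Summable.of_norm_bounded (hsum.add hxs) hkabs
    set q : ℝ → ℝ := fun γ => (r γ * ((x : ℂ) / (x + γ * I))).re with hq
    have hqeq : ∀ γ, q γ = m γ * k γ + if γ = 0 then 1 else 0 := by
      intro γ
      rcases eq_or_ne γ 0 with rfl | hγ
      · have : (x : ℂ) ≠ 0 := by exact_mod_cast (by linarith : x ≠ 0)
        simp [hq, hr0, hm0, this]
      · simp only [hq, hγ, if_false, add_zero]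
        rw [hr γ hγ]
        have e : (analyticOrderNatAt Φ (γ * I) : ℂ) / (1 / 2 + γ * I) * ((x : ℂ) / (x + γ * I)) =
            ((m γ * x : ℝ) : ℂ) * (((x / 2 - γ ^ 2 : ℝ) : ℂ) + ((γ * (x + 1 / 2) : ℝ) : ℂ) * I)⁻¹ := by
          rw [div_mul_div_comm, div_eq_mul_inv]
          push_cast [hm]
          congr 2
          linear_combination (γ : ℂ) ^ 2 * I_sq
        rw [e, re_ofReal_mul, inv_re, add_re, ofReal_re, re_ofReal_mul, I_re, normSq_add_mul_I, hk]
        have : (x / 2 - γ ^ 2) ^ 2 + (γ * (x + 1 / 2)) ^ 2 = (1 / 4 + γ ^ 2) * (x ^ 2 + γ ^ 2) := by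
          ring
        rw [this]
        ring
    have hdelta : HasSum (fun γ : ℝ => if γ = 0 then (1 : ℝ) else 0) 1 := by
      simpa using hasSum_ite_eq (0 : ℝ) (1 : ℝ)
    have hqs : HasSum q (∑' γ, m γ * k γ + 1) := by
      rw [show q = fun γ => m γ * k γ + if γ = 0 then 1 else 0 from funext hqeq]
      exact hks.hasSum.add hdelta
    have hqpos : 0 ≤ ∑' γ, q γ := by
      refine tsum_nonneg_of_forall_sum_sub_nonneg hqs.summable fun G => ?_
      have := hpos G x (by linarith)
      simpa only [hq, re_sum] using this
    rw [hqs.tsum_eq] at hqpos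
    have hfin := hks.tsum_le_tsum hkle (hsum.sub hxs)
    rw [hsum.tsum_sub hxs] at hfin
    have hF := hxs.sum_le_tsum F (fun γ _ => by have := hm_nonneg γ; positivity)
    linarith
  refine ⟨1 + W, fun x hx => ?_⟩
  have hl := (hlim x (by linarith)).sub (hlim 1 one_ne_zero)
  rw [ofReal_one] at hl
  suffices h : Real.log ‖Φ x‖ - Real.log ‖Φ 0‖ - (Real.log ‖Φ 1‖ - Real.log ‖Φ 0‖) ≤
      (1 + W) * (x - 1) by linarith
  refine le_of_tendsto' hl fun R => ?_
  set h : ℝ → ℝ := fun y => ∑ γ ∈ S R, m γ * (Real.log (1 + y ^ 2 / γ ^ 2) / 2) with hh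
  have hder : ∀ y : ℝ, HasDerivAt h (∑ γ ∈ S R, m γ * (y / (y ^ 2 + γ ^ 2))) y := by
    intro y
    refine HasDerivAt.fun_sum fun γ hγ => HasDerivAt.const_mul _ ?_
    have hγ0 : γ ≠ 0 := by
      rintro rfl
      have := ((hS R 0).1 hγ).2
      simp at this
      exact hΦ0 this
    have hp : 0 < 1 + y ^ 2 / γ ^ 2 := by positivity
    have h1 := ((((hasDerivAt_pow 2 y).div_const (γ ^ 2)).const_add 1).log hp.ne').div_const 2
    convert! h1 using 1
    have : 0 < y ^ 2 + γ ^ 2 := by positivity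
    field_simp
    ring
  have := Convex.image_sub_le_mul_sub_of_deriv_le (convex_Ici (1 : ℝ))
    (fun y _ => (hder y).continuousAt.continuousWithinAt)
    (fun y _ => (hder y).differentiableAt.differentiableWithinAt) (C := 1 + W)
    (fun y hy => by
      rw [(hder y).deriv]
      rw [interior_Ici] at hy
      exact hbound y (le_of_lt hy) (S R)) 1 (mem_Ici.2 le_rfl) x (mem_Ici.2 hx) hx
  exact this

open Complex Set MeasureTheory HurwitzZeta in
theorem one_le_evenKernel_zero {t : ℝ} (ht : 0 < t) : 1 ≤ evenKernel 0 t := by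
  have h := hasSum_int_evenKernel 0 ht
  have h1 := h.summable.le_tsum (0 : ℤ) (fun _ _ => (Real.exp_pos _).le)
  rw [h.tsum_eq] at h1
  simpa using h1

open Complex Set MeasureTheory HurwitzZeta in
/-- The Mellin kernel of `completedRiemannZeta₀` is nonnegative. -/
theorem exists_nonneg_f_modif_hurwitzEvenFEPair_zero (t : ℝ) :
    ∃ u : ℝ, 0 ≤ u ∧ (hurwitzEvenFEPair 0).f_modif t = u := by
  rcases lt_trichotomy t 1 with h | rfl | h
  · by_cases h0 : 0 < t
    · refine ⟨evenKernel 0 t - t ^ (-(1 / 2) : ℝ), ?_, ?_⟩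
      · rw [evenKernel_functional_equation, ← evenKernel_eq_cosKernel_of_zero, Real.rpow_neg h0.le,
          sub_nonneg, ← one_div]
        exact le_mul_of_one_le_right (by positivity) (one_le_evenKernel_zero (by positivity))
      · simp [WeakFEPair.f_modif, h, h0, h.le, hurwitzEvenFEPair]
    · exact ⟨0, le_rfl, by simp [WeakFEPair.f_modif, h0, h.le]⟩
  · exact ⟨0, le_rfl, by simp [WeakFEPair.f_modif]⟩
  · refine ⟨evenKernel 0 t - 1, by linarith [one_le_evenKernel_zero (zero_lt_one.trans h)], ?_⟩
    simp [WeakFEPair.f_modif, h, h.le, hurwitzEvenFEPair]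

open Complex Set MeasureTheory HurwitzZeta in
/-- On a strip symmetric about the critical line, `completedRiemannZeta₀` is controlled by its
value at the right end. -/
theorem norm_completedRiemannZeta₀_le {s : ℂ} {τ : ℝ} (h1 : 1 - τ ≤ s.re) (h2 : s.re ≤ τ) :
    ‖completedRiemannZeta₀ s‖ ≤ 2 * ‖completedRiemannZeta₀ τ‖ := by
  set P := hurwitzEvenFEPair 0
  choose u hu0 hu using exists_nonneg_f_modif_hurwitzEvenFEPair_zero
  have hconv : ∀ s, MellinConvergent P.f_modif s :=
    fun s => (P.isStrongFEPair_toStrongFEPair.hasMellin s).1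
  have hdef : ∀ s, completedRiemannZeta₀ s = mellin P.f_modif (s / 2) / 2 := fun s => rfl
  have hnorm : ∀ (z : ℂ), ∀ t ∈ Ioi (0 : ℝ), ‖(t : ℂ) ^ (z - 1) • P.f_modif t‖ =
      t ^ (z.re - 1) * u t := by
    intro z t ht
    rw [norm_smul, norm_cpow_eq_rpow_re_of_pos ht, hu t, norm_real, Real.norm_of_nonneg (hu0 t)]
    simp
  have hInt : ∀ σ : ℝ, IntegrableOn (fun t : ℝ => t ^ (σ - 1) * u t) (Ioi 0) := by
    intro σ
    have := Integrable.norm (hconv (σ : ℂ))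
    refine IntegrableOn.congr_fun this ?_ measurableSet_Ioi
    intro t ht
    simpa using hnorm σ t ht
  have hreal : ∀ σ : ℝ, mellin P.f_modif (σ : ℂ) =
      ((∫ t in Ioi (0 : ℝ), t ^ (σ - 1) * u t : ℝ) : ℂ) := by
    intro σ
    rw [mellin, ← integral_complex_ofReal]
    refine setIntegral_congr_fun measurableSet_Ioi fun t ht => ?_
    simp only [smul_eq_mul]
    rw [hu t, ofReal_mul, ofReal_cpow (le_of_lt ht)]
    simp
  have hnn : ∀ σ : ℝ, 0 ≤ ∫ t in Ioi (0 : ℝ), t ^ (σ - 1) * u t := by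
    intro σ
    refine setIntegral_nonneg measurableSet_Ioi fun t ht => ?_
    have : (0 : ℝ) < t := ht
    have := hu0 t
    positivity
  have hle : ‖mellin P.f_modif (s / 2)‖ ≤ ∫ t in Ioi (0 : ℝ),
      (t ^ ((1 - τ) / 2 - 1) * u t + t ^ (τ / 2 - 1) * u t) := by
    refine (norm_integral_le_integral_norm _).trans ?_
    refine setIntegral_mono_on (hconv _).norm ((hInt _).add (hInt _)) measurableSet_Ioi ?_
    intro t ht
    have ht0 : (0 : ℝ) < t := ht
    rw [hnorm _ t ht, ← add_mul]
    refine mul_le_mul_of_nonneg_right ?_ (hu0 t)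
    have hre : (s / 2).re = s.re / 2 := by simp
    rw [hre]
    rcases le_total t 1 with h | h
    · have := Real.rpow_le_rpow_of_exponent_ge ht0 h
        (show (1 - τ) / 2 - 1 ≤ s.re / 2 - 1 by linarith)
      have h3 : 0 ≤ t ^ (τ / 2 - 1) := by positivity
      linarith
    · have := Real.rpow_le_rpow_of_exponent_le h
        (show s.re / 2 - 1 ≤ τ / 2 - 1 by linarith)
      have h3 : 0 ≤ t ^ ((1 - τ) / 2 - 1) := by positivity
      linarith
  rw [integral_add (hInt _) (hInt _)] at hle
  have e1 : ‖completedRiemannZeta₀ τ‖ = (∫ t in Ioi (0 : ℝ), t ^ (τ / 2 - 1) * u t) / 2 := by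
    rw [hdef, show (τ : ℂ) / 2 = ((τ / 2 : ℝ) : ℂ) by push_cast; rfl, hreal, norm_div, norm_real,
      Real.norm_of_nonneg (hnn _)]
    simp
  have e2 : ‖completedRiemannZeta₀ τ‖ = (∫ t in Ioi (0 : ℝ), t ^ ((1 - τ) / 2 - 1) * u t) / 2 := by
    rw [← completedRiemannZeta₀_one_sub, hdef,
      show (1 - τ : ℂ) / 2 = (((1 - τ) / 2 : ℝ) : ℂ) by push_cast; rfl, hreal, norm_div, norm_real,
      Real.norm_of_nonneg (hnn _)]
    simp
  rw [hdef, norm_div, norm_ofNat]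
  linarith

/-- Twice the Riemann `ξ`-function, centred at the critical point `1 / 2`. -/
noncomputable def xiCentered (w : ℂ) : ℂ :=
  (w ^ 2 - 1 / 4) * completedRiemannZeta₀ (1 / 2 + w) + 1

theorem differentiable_xiCentered : Differentiable ℂ xiCentered := by
  unfold xiCentered
  have := differentiable_completedZeta₀
  fun_prop

theorem xiCentered_neg (w : ℂ) : xiCentered (-w) = xiCentered w := by
  rw [xiCentered, xiCentered, ← completedRiemannZeta₀_one_sub]
  congr 3 <;> ring

theorem riemannZeta₁_eq_sub_one_mul {s : ℂ} (hs : s ≠ 1) :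
    riemannZeta₁ s = (s - 1) * riemannZeta s := by
  rw [riemannZeta_eq_inv_sub_mul hs, mul_inv_cancel_left₀ (sub_ne_zero.2 hs)]

theorem xiCentered_sub_half {s : ℂ} (hs : 0 < s.re) :
    xiCentered (s - 1 / 2) = s * s.Gammaℝ * riemannZeta₁ s := by
  have hs0 : s ≠ 0 := by rintro rfl; simp at hs
  rw [xiCentered, show (1 / 2 : ℂ) + (s - 1 / 2) = s by ring]
  rcases eq_or_ne s 1 with rfl | hs1
  · simp [Complex.Gammaℝ_one]
    norm_num
  · have hG := Complex.Gammaℝ_ne_zero_of_re_pos hs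
    have h1 : (1 : ℂ) - s ≠ 0 := sub_ne_zero.2 hs1.symm
    rw [riemannZeta₁_eq_sub_one_mul hs1, riemannZeta_def_of_ne_zero hs0, completedRiemannZeta_eq]
    field_simp
    ring

theorem riemannZeta₁_eq_zero_iff_xiCentered {s : ℂ} (hs : 0 < s.re) :
    riemannZeta₁ s = 0 ↔ xiCentered (s - 1 / 2) = 0 := by
  have hs0 : s ≠ 0 := by rintro rfl; simp at hs
  rw [xiCentered_sub_half hs, mul_eq_zero_iff_left]
  exact mul_ne_zero hs0 (Complex.Gammaℝ_ne_zero_of_re_pos hs)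

theorem norm_completedRiemannZeta₀_one_lt : ‖completedRiemannZeta₀ 1‖ < 3 / 2 := by
  have h : completedRiemannZeta₀ 1 =
      (((Real.eulerMascheroniConstant - Real.log (4 * Real.pi)) / 2 + 1 : ℝ) : ℂ) := by
    rw [completedRiemannZeta₀_one]
    push_cast [Complex.ofReal_log (show (0 : ℝ) ≤ 4 * Real.pi by positivity)]
    rfl
  rw [h, Complex.norm_real, Real.norm_eq_abs, abs_lt]
  have h1 := Real.eulerMascheroniConstant_lt_two_thirds
  have h2 := Real.one_half_lt_eulerMascheroniConstant
  have h3 : 0 ≤ Real.log (4 * Real.pi) := Real.log_nonneg (by linarith [Real.pi_gt_three])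
  have h4 : Real.log (4 * Real.pi) < 5 := by
    rw [Real.log_lt_iff_lt_exp (by positivity)]
    have h5 : (2.7 : ℝ) ^ 5 < Real.exp 1 ^ 5 :=
      pow_lt_pow_left₀ (by linarith [Real.exp_one_gt_d9]) (by norm_num) (by norm_num)
    rw [← Real.exp_nat_mul] at h5
    norm_num at h5
    linarith [Real.pi_lt_four]
  constructor <;> linarith

/-- `(s - 1) ζ(s)` does not vanish on the real segment `[0, 1]`. -/
theorem riemannZeta₁_ofReal_ne_zero {σ : ℝ} (h0 : 0 < σ) (h1 : σ ≤ 1) :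
    riemannZeta₁ σ ≠ 0 := by
  rw [Ne, riemannZeta₁_eq_zero_iff_xiCentered (by simpa using h0), xiCentered,
    show (1 / 2 : ℂ) + (σ - 1 / 2) = σ by ring]
  intro h
  have hn := norm_completedRiemannZeta₀_le (s := σ) (τ := 1) (by simpa using h0.le) (by simpa using h1)
  rw [Complex.ofReal_one] at hn
  have h2 : ((σ * (1 - σ) : ℝ) : ℂ) * completedRiemannZeta₀ σ = 1 := by
    push_cast
    linear_combination -h
  have h3 := congrArg norm h2
  have h4 : 0 ≤ σ * (1 - σ) := mul_nonneg h0.le (by linarith)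
  rw [norm_mul, Complex.norm_real, Real.norm_of_nonneg h4, norm_one] at h3
  have h5 := norm_completedRiemannZeta₀_one_lt
  have h6 : σ * (1 - σ) ≤ 1 / 4 := by nlinarith [sq_nonneg (σ - 1 / 2)]
  nlinarith [norm_nonneg (completedRiemannZeta₀ σ)]

theorem xiCentered_zero_ne_zero : xiCentered 0 ≠ 0 := by
  have h := riemannZeta₁_ofReal_ne_zero (σ := 1 / 2) (by norm_num) (by norm_num)
  rw [Ne, riemannZeta₁_eq_zero_iff_xiCentered (by norm_num)] at h
  simpa using h

theorem analyticOrderNatAt_xiCentered (γ : ℝ) :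
    analyticOrderNatAt xiCentered (γ * Complex.I) =
      analyticOrderNatAt riemannZeta₁ (1 / 2 + γ * Complex.I) := by
  set s₀ : ℂ := 1 / 2 + γ * Complex.I with hs₀
  have hre : 0 < s₀.re := by simp [hs₀]
  have hs00 : s₀ ≠ 0 := by intro h; rw [h] at hre; simp at hre
  have hZ : AnalyticAt ℂ riemannZeta₁ s₀ := differentiable_riemannZeta₁.analyticAt _
  have hX : AnalyticAt ℂ xiCentered (γ * Complex.I) := differentiable_xiCentered.analyticAt _
  have hGd : AnalyticAt ℂ Complex.Gammaℝ s₀ := by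
    have h1 : AnalyticAt ℂ (fun s => (Complex.Gammaℝ s)⁻¹) s₀ :=
      Complex.differentiable_Gammaℝ_inv.analyticAt _
    have h2 := h1.inv (inv_ne_zero (Complex.Gammaℝ_ne_zero_of_re_pos hre))
    refine h2.congr (Filter.Eventually.of_forall fun s => ?_)
    simp
  have hev : (fun s => xiCentered (s - 1 / 2)) =ᶠ[nhds s₀]
      (fun s => s * s.Gammaℝ) * riemannZeta₁ := by
    filter_upwards [(isOpen_lt continuous_const Complex.continuous_re).mem_nhds hre] with s hs
    exact xiCentered_sub_half hs
  have hU : AnalyticAt ℂ (fun s => s * s.Gammaℝ) s₀ := analyticAt_id.mul hGd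
  have hord : analyticOrderAt (fun s => xiCentered (s - 1 / 2)) s₀ =
      analyticOrderAt riemannZeta₁ s₀ := by
    rw [analyticOrderAt_congr hev, analyticOrderAt_mul hU hZ, hU.analyticOrderAt_eq_zero.2, zero_add]
    exact mul_ne_zero hs00 (Complex.Gammaℝ_ne_zero_of_re_pos hre)
  have hpt : s₀ - 1 / 2 = γ * Complex.I := by rw [hs₀]; ring
  have hcomp : analyticOrderAt (xiCentered ∘ fun s => s - 1 / 2) s₀ =
      analyticOrderAt xiCentered (s₀ - 1 / 2) := by
    refine analyticOrderAt_comp_of_deriv_ne_zero (by fun_prop) ?_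
    simp
  unfold analyticOrderNatAt
  rw [← hord, ← hpt, ← hcomp]
  rfl

open Complex Filter Asymptotics in
theorem norm_riemannZeta_two_mul_mem_Icc {n : ℕ} (hn : 1 ≤ n) :
    ‖riemannZeta (2 * n : ℕ)‖ ∈ Set.Icc 1 2 := by
  have hk : 1 < 2 * n := by lia
  have hs : Summable fun m : ℕ => 1 / (m : ℝ) ^ (2 * n) := Real.summable_one_div_nat_pow.2 hk
  have heq : riemannZeta (2 * n : ℕ) = ((∑' m : ℕ, 1 / (m : ℝ) ^ (2 * n) : ℝ) : ℂ) := by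
    rw [zeta_nat_eq_tsum_of_gt_one hk]
    push_cast
    rfl
  have h0 : ∀ m : ℕ, 0 ≤ 1 / (m : ℝ) ^ (2 * n) := fun m => by positivity
  rw [heq, norm_real, Real.norm_of_nonneg (tsum_nonneg h0)]
  constructor
  · simpa using hs.le_tsum 1 fun m _ => h0 m
  · have h2 := hasSum_zeta_two
    calc ∑' m : ℕ, 1 / (m : ℝ) ^ (2 * n) ≤ ∑' m : ℕ, 1 / (m : ℝ) ^ 2 := by
          refine hs.tsum_le_tsum (fun m => ?_) h2.summable
          rcases m.eq_zero_or_pos with rfl | hm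
          · simp [show n ≠ 0 by lia]
          · have : (1 : ℝ) ≤ m := by exact_mod_cast hm
            gcongr
            lia
      _ = Real.pi ^ 2 / 6 := h2.tsum_eq
      _ ≤ 2 := by nlinarith [Real.pi_lt_d2, Real.pi_pos]

open Complex in
theorem norm_xiCentered_two_mul_sub_half {n : ℕ} (hn : 1 ≤ n) :
    ‖xiCentered ((2 * n : ℕ) - 1 / 2)‖ =
      2 * n * (2 * n - 1) * ((n - 1).factorial / Real.pi ^ n) * ‖riemannZeta (2 * n : ℕ)‖ := by
  have hG : Complex.Gammaℝ (2 * n : ℕ) = (((n - 1).factorial / Real.pi ^ n : ℝ) : ℂ) := by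
    obtain ⟨m, rfl⟩ := Nat.exists_eq_add_of_le' hn
    rw [Complex.Gammaℝ_def]
    have h1 : ((2 * (m + 1) : ℕ) : ℂ) / 2 = m + 1 := by push_cast; ring
    have h2 : -((2 * (m + 1) : ℕ) : ℂ) / 2 = -((m + 1 : ℕ) : ℂ) := by push_cast; ring
    rw [h1, h2, Complex.Gamma_nat_eq_factorial, Complex.cpow_neg, Complex.cpow_natCast]
    push_cast
    simp [div_eq_mul_inv, mul_comm]
  have hn1 : (1 : ℝ) ≤ n := by exact_mod_cast hn
  have h1 : ((2 * n : ℕ) : ℂ) ≠ 1 := by exact_mod_cast (by lia : 2 * n ≠ 1)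
  rw [xiCentered_sub_half (by rw [natCast_re]; positivity), riemannZeta₁_eq_sub_one_mul h1, hG]
  have h2 : ((2 * n : ℕ) : ℂ) - 1 = ((2 * n - 1 : ℝ) : ℂ) := by push_cast; ring
  rw [h2, norm_mul, norm_mul, norm_mul, norm_real, norm_real,
    Real.norm_of_nonneg (by linarith : (0 : ℝ) ≤ 2 * n - 1), Complex.norm_natCast,
    Real.norm_of_nonneg (by positivity)]
  push_cast
  ring

theorem norm_completedRiemannZeta₀_two_mul_le {n : ℕ} (hn : 1 ≤ n) :
    ‖completedRiemannZeta₀ (2 * n : ℕ)‖ ≤ 9 * (n : ℝ) ^ (n + 2) := by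
  have hn1 : (1 : ℝ) ≤ n := by exact_mod_cast hn
  have h := norm_xiCentered_two_mul_sub_half hn
  have hz := (norm_riemannZeta_two_mul_mem_Icc hn).2
  have hf : ((n - 1).factorial : ℝ) ≤ (n : ℝ) ^ n := by
    exact_mod_cast (Nat.factorial_le (Nat.sub_le n 1)).trans n.factorial_le_pow
  have hπ : 1 ≤ Real.pi ^ n := one_le_pow₀ (by linarith [Real.pi_gt_three])
  have hd : ((n - 1).factorial : ℝ) / Real.pi ^ n ≤ (n : ℝ) ^ n :=
    (div_le_self (by positivity) hπ).trans hf
  have hΦ : ‖xiCentered ((2 * n : ℕ) - 1 / 2)‖ ≤ 8 * (n : ℝ) ^ (n + 2) := by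
    rw [h]
    calc 2 * (n : ℝ) * (2 * n - 1) * ((n - 1).factorial / Real.pi ^ n) * ‖riemannZeta (2 * n : ℕ)‖
        ≤ 2 * n * (2 * n) * (n : ℝ) ^ n * 2 := by
          gcongr
          nlinarith
      _ = 8 * (n : ℝ) ^ (n + 2) := by ring
  have he : (2 * (n : ℂ) * (2 * n - 1)) * completedRiemannZeta₀ (2 * n : ℕ) =
      xiCentered ((2 * n : ℕ) - 1 / 2) - 1 := by
    rw [xiCentered]
    push_cast
    ring_nf
  have hc : ‖(2 * (n : ℂ) * (2 * n - 1))‖ = 2 * n * (2 * n - 1) := by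
    have : (2 * (n : ℂ) * (2 * n - 1)) = ((2 * n * (2 * n - 1) : ℝ) : ℂ) := by push_cast; ring
    rw [this, Complex.norm_real, Real.norm_of_nonneg (by nlinarith)]
  have hp : 1 ≤ (n : ℝ) ^ (n + 2) := one_le_pow₀ hn1
  calc ‖completedRiemannZeta₀ (2 * n : ℕ)‖
      ≤ 2 * n * (2 * n - 1) * ‖completedRiemannZeta₀ (2 * n : ℕ)‖ :=
        le_mul_of_one_le_left (norm_nonneg _) (by nlinarith)
    _ = ‖xiCentered ((2 * n : ℕ) - 1 / 2) - 1‖ := by rw [← he, norm_mul, hc]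
    _ ≤ ‖xiCentered ((2 * n : ℕ) - 1 / 2)‖ + 1 := by simpa using norm_sub_le _ (1 : ℂ)
    _ ≤ 9 * (n : ℝ) ^ (n + 2) := by linarith

theorem norm_xiCentered_le (w : ℂ) :
    ‖xiCentered w‖ ≤ Real.exp (Real.log 19 + (‖w‖ + 8) * Real.log (‖w‖ + 4)) := by
  set n : ℕ := ⌈‖w‖⌉₊ + 2 with hn
  have hr := norm_nonneg w
  have h1 : ‖w‖ + 2 ≤ n := by rw [hn]; push_cast; linarith [Nat.le_ceil ‖w‖]
  have h2 : (n : ℝ) ≤ ‖w‖ + 4 := by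
    rw [hn]; push_cast; linarith [Nat.ceil_lt_add_one hr]
  have hre := abs_le.1 (Complex.abs_re_le_norm w)
  have hΛ : ‖completedRiemannZeta₀ (1 / 2 + w)‖ ≤ 2 * ‖completedRiemannZeta₀ (2 * n : ℕ)‖ := by
    have := norm_completedRiemannZeta₀_le (s := 1 / 2 + w) (τ := (2 * n : ℕ))
      (by simp; linarith) (by simp; linarith)
    simpa using this
  have hp : 1 ≤ (n : ℝ) ^ (n + 4) := one_le_pow₀ (by linarith)
  have hw : ‖w ^ 2 - 1 / 4‖ ≤ (n : ℝ) ^ 2 := by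
    calc ‖w ^ 2 - 1 / 4‖ ≤ ‖w ^ 2‖ + ‖(1 / 4 : ℂ)‖ := norm_sub_le _ _
      _ ≤ (n : ℝ) ^ 2 := by rw [norm_pow]; norm_num; nlinarith
  have hΛn := norm_completedRiemannZeta₀_two_mul_le (n := n) (by lia)
  calc ‖xiCentered w‖ ≤ ‖w ^ 2 - 1 / 4‖ * ‖completedRiemannZeta₀ (1 / 2 + w)‖ + 1 := by
        rw [xiCentered, ← norm_mul]
        exact (norm_add_le _ _).trans_eq (by rw [norm_one])
    _ ≤ (n : ℝ) ^ 2 * (2 * (9 * (n : ℝ) ^ (n + 2))) + 1 := by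
        gcongr
        exact hΛ.trans (by gcongr)
    _ = 18 * (n : ℝ) ^ (n + 4) + 1 := by ring
    _ ≤ 19 * (n : ℝ) ^ (n + 4) := by linarith
    _ = Real.exp (Real.log 19 + (n + 4) * Real.log n) := by
        rw [Real.exp_add, Real.exp_log (by norm_num), mul_comm ((n : ℝ) + 4), Real.exp_mul,
          Real.exp_log (by linarith)]
        norm_cast
    _ ≤ _ := by
        have : 0 ≤ Real.log n := Real.log_nonneg (by linarith)
        gcongr Real.exp (_ + ?_ * Real.log ?_)
        linarith

open Filter Asymptotics in
theorem isLittleO_add_mul_log_sq :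
    (fun r : ℝ => Real.log 19 + (r + 8) * Real.log (r + 4)) =o[atTop] fun r => r ^ 2 := by
  have hid : Tendsto (fun r : ℝ => r + 4) atTop atTop := tendsto_atTop_add_const_right _ _ tendsto_id
  have h4 : (fun r : ℝ => r + 4) =O[atTop] fun r => r :=
    (isBigO_refl _ _).add (isLittleO_const_id_atTop (4 : ℝ)).isBigO
  have h8 : (fun r : ℝ => r + 8) =O[atTop] fun r => r :=
    (isBigO_refl _ _).add (isLittleO_const_id_atTop (8 : ℝ)).isBigO
  have hlog : (fun r : ℝ => Real.log (r + 4)) =o[atTop] fun r => r :=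
    (Real.isLittleO_log_id_atTop.comp_tendsto hid).trans_isBigO h4
  refine IsLittleO.add ?_ ?_
  · refine isLittleO_const_left.2 (Or.inr ?_)
    exact tendsto_norm_atTop_atTop.comp (tendsto_pow_atTop two_ne_zero)
  · simpa only [sq] using h8.mul_isLittleO hlog

open Complex Filter Asymptotics in
theorem not_forall_log_norm_xiCentered_le :
    ¬ ∃ C, ∀ x : ℝ, 1 ≤ x → Real.log ‖xiCentered x‖ ≤ Real.log ‖xiCentered 1‖ + C * (x - 1) := by
  rintro ⟨C, hC⟩
  set K := Real.log ‖xiCentered 1‖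
  set a := Real.exp (2 * |C|)
  have hlim := (FloorSemiring.tendsto_pow_div_factorial_atTop (Real.pi * a))
  have hpos : 0 < (Real.exp (K + 2 * |C|) * (Real.pi * a))⁻¹ := by positivity
  obtain ⟨n, hn⟩ := (hlim.eventually_lt_const hpos).exists
  have h := hC ((2 * (n + 1) : ℕ) - 1 / 2) (by push_cast; linarith [(n.cast_nonneg : (0:ℝ) ≤ n)])
  have hval := norm_xiCentered_two_mul_sub_half (n := n + 1) (by lia)
  have hz := (norm_riemannZeta_two_mul_mem_Icc (n := n + 1) (by lia)).1
  have hn0 : (0 : ℝ) ≤ n := n.cast_nonneg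
  have hlow : n.factorial / Real.pi ^ (n + 1) ≤ ‖xiCentered ((2 * (n + 1) : ℕ) - 1 / 2)‖ := by
    rw [hval, Nat.add_sub_cancel]
    set q := (n.factorial : ℝ) / Real.pi ^ (n + 1)
    have hq : 0 ≤ q := by positivity
    have hc : 1 ≤ 2 * ((n + 1 : ℕ) : ℝ) * (2 * (n + 1 : ℕ) - 1) := by push_cast; nlinarith
    calc q = 1 * q * 1 := by ring
      _ ≤ _ := by gcongr
  have hq : 0 < (n.factorial : ℝ) / Real.pi ^ (n + 1) := by positivity
  have hcast : (((2 * (n + 1) : ℕ) - 1 / 2 : ℝ) : ℂ) = (2 * (n + 1) : ℕ) - 1 / 2 := by push_cast; ring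
  rw [hcast] at h
  have hup : ‖xiCentered ((2 * (n + 1) : ℕ) - 1 / 2)‖ ≤ Real.exp (K + 2 * |C|) * a ^ (n + 1) := by
    rw [← Real.exp_nat_mul, ← Real.exp_add, ← Real.log_le_iff_le_exp (hq.trans_le hlow)]
    refine h.trans ?_
    push_cast
    nlinarith [le_abs_self C, abs_nonneg C]
  have hfin := hlow.trans hup
  rw [div_le_iff₀ (by positivity)] at hfin
  have hf : (0 : ℝ) < n.factorial := by positivity
  rw [div_lt_iff₀ hf, inv_mul_eq_div, lt_div_iff₀ (by positivity)] at hn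
  have : (Real.pi * a) ^ n * (Real.exp (K + 2 * |C|) * (Real.pi * a)) =
    Real.exp (K + 2 * |C|) * a ^ (n + 1) * Real.pi ^ (n + 1) := by rw [mul_pow]; ring
  linarith

open Complex in
theorem exists_sum_sub_neg_of_riemannZeta₁_ne_zero
    (hRH : ∀ s : ℂ, 1 / 2 < s.re → riemannZeta₁ s ≠ 0) {r : ℝ → ℂ} (hr0 : r 0 = 1)
    (hr : ∀ γ ≠ 0, r γ = analyticOrderNatAt riemannZeta₁ (1 / 2 + γ * I) / (1 / 2 + γ * I)) :
    ∃ F : Finset ℝ, ∃ x : ℝ, 0 < x ∧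
      (∑ a ∈ F, ∑ b ∈ F, r (a - b) * ((x : ℂ) / (x + (a - b : ℝ) * I))).re < 0 := by
  by_contra! hpos
  have hle : ∀ w, xiCentered w = 0 → w.re ≤ 0 := by
    intro w hw
    by_contra! h
    refine hRH (w + 1 / 2) (by simpa using h) ?_
    rw [riemannZeta₁_eq_zero_iff_xiCentered (by simp; linarith)]
    simpa using hw
  have hzero : ∀ w, xiCentered w = 0 → w.re = 0 := fun w hw =>
    le_antisymm (hle w hw) (by
      have := hle (-w) (by rw [xiCentered_neg, hw])
      simpa using this)
  refine not_forall_log_norm_xiCentered_le ?_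
  exact exists_log_norm_le_of_forall_sum_sub_nonneg differentiable_xiCentered
    xiCentered_zero_ne_zero xiCentered_neg hzero norm_xiCentered_le isLittleO_add_mul_log_sq hr0
    (fun γ hγ => by rw [hr γ hγ, analyticOrderNatAt_xiCentered]) hpos

open MeasureTheory ProbabilityTheory Filter Topology in
theorem norm_integral_pow_mul_cexp_of_nonpos {Ω : Type*} [MeasurableSpace Ω] {ν : Measure Ω}
    {Y : Ω → ℝ} (hY : ∀ᵐ ω ∂ν, Y ω ≤ 0) (b : ℝ) (n : ℕ) :
    ‖∫ ω, (Y ω : ℂ) ^ n * Complex.exp (b * Y ω) ∂ν‖ =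
      ∫ ω, (-Y ω) ^ n * Real.exp (b * Y ω) ∂ν := by
  have h : ∀ ω, (Y ω : ℂ) ^ n * Complex.exp (b * Y ω) =
      (-1 : ℂ) ^ n * (((-Y ω) ^ n * Real.exp (b * Y ω) : ℝ) : ℂ) := by
    intro ω
    push_cast
    rw [← mul_assoc, ← mul_pow]
    simp
  simp_rw [h]
  rw [integral_const_mul, integral_complex_ofReal, norm_mul, norm_pow, norm_neg, norm_one, one_pow,
    one_mul, Complex.norm_real, Real.norm_of_nonneg]
  refine integral_nonneg_of_ae ?_
  filter_upwards [hY] with ω hω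
  have : 0 ≤ -Y ω := by linarith
  positivity

open MeasureTheory ProbabilityTheory Filter Topology in
/-- **Landau's theorem**: a Laplace transform of a positive measure converges as far to the left as
its analytic continuation. -/
theorem mem_integrableExpSet_of_differentiableOn_ball {Ω : Type*} [MeasurableSpace Ω]
    {ν : Measure Ω} {Y : Ω → ℝ} (hY : ∀ᵐ ω ∂ν, Y ω ≤ 0) {b R t : ℝ}
    (hb : b ∈ interior (integrableExpSet Y ν)) {H : ℂ → ℂ}
    (hH : DifferentiableOn ℂ H (Metric.ball (b : ℂ) R)) (hHG : H =ᶠ[𝓝 (b : ℂ)] complexMGF Y ν)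
    (ht0 : 0 ≤ t) (htR : t < R) : b - t ∈ integrableExpSet Y ν := by
  have hYm : AEMeasurable Y ν := aemeasurable_of_mem_interior_integrableExpSet hb
  obtain ⟨ρ, htρ, hρR⟩ := exists_between htR
  have hρ : 0 < ρ := ht0.trans_lt htρ
  have hsub : Metric.closedBall (b : ℂ) ρ ⊆ Metric.ball (b : ℂ) R :=
    Metric.closedBall_subset_ball hρR
  obtain ⟨C, hC⟩ := (isCompact_sphere (b : ℂ) ρ).exists_bound_of_continuousOn
    (hH.continuousOn.mono (Metric.sphere_subset_closedBall.trans hsub))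
  have hderiv : ∀ n : ℕ, ∫ ω, (-Y ω) ^ n * Real.exp (b * Y ω) ∂ν ≤ n.factorial * C / ρ ^ n := by
    intro n
    rw [← norm_integral_pow_mul_cexp_of_nonpos hY, ← iteratedDeriv_complexMGF (by simpa using hb) n,
      ← hHG.iteratedDeriv_eq n]
    exact Complex.norm_iteratedDeriv_le_of_forall_mem_sphere_norm_le n hρ
      ((hH.mono hsub).diffContOnCl_ball le_rfl) hC
  have hInt : ∀ n : ℕ, Integrable (fun ω => (-Y ω) ^ n * Real.exp (b * Y ω)) ν := by
    intro n
    have := (integrable_pow_mul_exp_of_mem_interior_integrableExpSet hb n).const_mul ((-1) ^ n)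
    refine this.congr (ae_of_all _ fun ω => ?_)
    simp only
    rw [← mul_assoc, ← mul_pow, neg_one_mul]
  have hterm : ∀ n : ℕ, ∫⁻ ω, ENNReal.ofReal (t ^ n / n.factorial *
      ((-Y ω) ^ n * Real.exp (b * Y ω))) ∂ν ≤ ENNReal.ofReal (C * (t / ρ) ^ n) := by
    intro n
    rw [← ofReal_integral_eq_lintegral_ofReal ((hInt n).const_mul _)]
    · refine ENNReal.ofReal_le_ofReal ?_
      rw [integral_const_mul]
      calc t ^ n / n.factorial * ∫ ω, (-Y ω) ^ n * Real.exp (b * Y ω) ∂ν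
          ≤ t ^ n / n.factorial * (n.factorial * C / ρ ^ n) := by
            gcongr
            exact hderiv n
        _ = C * (t / ρ) ^ n := by rw [div_pow]; field_simp
    · filter_upwards [hY] with ω hω
      have : 0 ≤ -Y ω := by linarith
      positivity
  have hsum : ∀ᵐ ω ∂ν, ENNReal.ofReal (Real.exp ((b - t) * Y ω)) =
      ∑' n : ℕ, ENNReal.ofReal (t ^ n / n.factorial * ((-Y ω) ^ n * Real.exp (b * Y ω))) := by
    filter_upwards [hY] with ω hω
    have h0 : 0 ≤ -Y ω := by linarith
    have hs := (NormedSpace.expSeries_div_hasSum_exp (t * -Y ω)).mul_right (Real.exp (b * Y ω))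
    rw [← Real.exp_eq_exp_ℝ, ← Real.exp_add] at hs
    rw [show (b - t) * Y ω = t * -Y ω + b * Y ω by ring, ← hs.tsum_eq,
      ENNReal.ofReal_tsum_of_nonneg (fun n => by positivity) hs.summable]
    congr 1 with n
    congr 1
    rw [mul_pow]
    ring
  refine ⟨(by fun_prop), ?_⟩
  rw [hasFiniteIntegral_iff_ofReal (ae_of_all _ fun ω => (Real.exp_pos _).le),
    lintegral_congr_ae hsum, lintegral_tsum (fun n => by fun_prop)]
  refine (ENNReal.tsum_le_tsum hterm).trans_lt ?_
  have hgeo : Summable fun n : ℕ => C * (t / ρ) ^ n :=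
    (summable_geometric_of_lt_one (by positivity) ((div_lt_one hρ).2 htρ)).mul_left C
  exact hgeo.tsum_ofReal_lt_top

theorem deriv_id_mul_eq {G : ℂ → ℂ} {s : ℂ} (hG : DifferentiableAt ℂ G s) :
    deriv (fun s => s * G s) s = G s + s * deriv G s := by
  have h := ((hasDerivAt_id s).fun_mul hG.hasDerivAt).deriv
  simpa using h

open MeasureTheory ProbabilityTheory Filter Topology in
/-- If the logarithmic-derivative-type equation `Z (s G)' + k = 0` holds for the Laplace transform
`G` of a positive measure in a half plane, and `Z` has no real zeros to the right of `c`, then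
`G` converges and the equation persists to the right of `c`. -/
theorem Ioi_subset_integrableExpSet_of_mul_deriv_add_eq_zero {Ω : Type*} [MeasurableSpace Ω]
    {ν : Measure Ω} {Y : Ω → ℝ} (hY : ∀ᵐ ω ∂ν, Y ω ≤ 0) {c : ℝ} (hc : 0 ≤ c)
    (hS : Set.Ioi 1 ⊆ integrableExpSet Y ν) {Z k : ℂ → ℂ} (hZ : Differentiable ℂ Z)
    (hk : DifferentiableOn ℂ k {s | c < s.re}) (hZr : ∀ σ : ℝ, c < σ → Z σ ≠ 0)
    (heq : ∀ s : ℂ, 1 < s.re → Z s * deriv (fun s => s * complexMGF Y ν s) s + k s = 0) :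
    Set.Ioi c ⊆ integrableExpSet Y ν ∧
    ∀ s : ℂ, c < s.re → Z s * deriv (fun s => s * complexMGF Y ν s) s + k s = 0 := by
  set S := integrableExpSet Y ν with hSdef
  set G := complexMGF Y ν
  have hup : ∀ s ∈ S, ∀ s', s ≤ s' → s' ∈ S := by
    intro s hs s' hss'
    rcases lt_or_ge 1 s' with h | h
    · exact hS h
    · exact convex_integrableExpSet.ordConnected.out hs (hS (show (2 : ℝ) ∈ Set.Ioi 1 by simp))
        ⟨hss', by linarith⟩
  have hext : ∀ d : ℝ, c ≤ d → Set.Ioi d ⊆ S →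
      ∀ s : ℂ, d < s.re → Z s * deriv (fun s => s * G s) s + k s = 0 := by
    intro d hcd hd
    have hopen : IsOpen {s : ℂ | d < s.re} := isOpen_lt continuous_const Complex.continuous_re
    have hconv : Convex ℝ {s : ℂ | d < s.re} := convex_halfSpace_re_gt d
    have hGd : DifferentiableOn ℂ G {s : ℂ | d < s.re} :=
      differentiableOn_complexMGF.mono fun s hs => interior_maximal hd isOpen_Ioi hs
    have hf : AnalyticOnNhd ℂ (fun s => Z s * deriv (fun s => s * G s) s + k s) {s | d < s.re} := by
      refine DifferentiableOn.analyticOnNhd ?_ hopen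
      refine (hZ.differentiableOn.mul ?_).add (hk.mono fun s hs => lt_of_le_of_lt hcd hs)
      exact (differentiableOn_id.mul hGd).deriv hopen
    intro s hs
    obtain ⟨τ, hτ⟩ := exists_gt (max d 1)
    have h0 := hf.eqOn_zero_of_preconnected_of_eventuallyEq_zero hconv.isPreconnected
      (z₀ := (τ : ℂ)) (by simpa using (le_max_left _ _).trans_lt hτ) (by
        have : {s : ℂ | 1 < s.re} ∈ 𝓝 (τ : ℂ) :=
          (isOpen_lt continuous_const Complex.continuous_re).mem_nhds
            (by simpa using (le_max_right _ _).trans_lt hτ)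
        filter_upwards [this] with s hs using heq s hs)
    exact h0 hs
  have hmain : Set.Ioi c ⊆ S := by
    by_contra hcon
    obtain ⟨s₀, hs₀, hs₀S⟩ := Set.not_subset.1 hcon
    have hlb : s₀ ∈ lowerBounds S := fun s hs => by
      by_contra! h
      exact hs₀S (hup s hs s₀ h.le)
    have hne : S.Nonempty := ⟨2, hS (by simp)⟩
    set d := sInf S with hd
    have hs₀d : s₀ ≤ d := le_csInf hne hlb
    have hcd : c < d := lt_of_lt_of_le hs₀ hs₀d
    have hdS : Set.Ioi d ⊆ S := by
      intro s hs
      obtain ⟨s', hs', hlt⟩ := exists_lt_of_csInf_lt hne (show sInf S < s from hs)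
      exact hup s' hs' s hlt.le
    have hV : IsOpen {s : ℂ | c < s.re ∧ Z s ≠ 0} :=
      (isOpen_lt continuous_const Complex.continuous_re).inter
        (isOpen_ne_fun hZ.continuous continuous_const)
    obtain ⟨ρ, hρ, hball⟩ := Metric.isOpen_iff.1 hV d ⟨by simpa using hcd, hZr d hcd⟩
    set b : ℝ := d + ρ / 4 with hbdef
    have hsub : Metric.ball (b : ℂ) (ρ / 2) ⊆ {s : ℂ | c < s.re ∧ Z s ≠ 0} := by
      refine (Metric.ball_subset_ball' ?_).trans hball
      rw [Complex.dist_of_im_eq (by simp), Real.dist_eq]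
      simp only [Complex.ofReal_re, hbdef, add_sub_cancel_left]
      rw [abs_of_pos (by positivity)]
      linarith
    have hQ : DifferentiableOn ℂ (fun s => -(k s / Z s)) (Metric.ball (b : ℂ) (ρ / 2)) :=
      ((hk.mono fun s hs => (hsub hs).1).div hZ.differentiableOn fun s hs => (hsub hs).2).neg
    obtain ⟨P, hP⟩ := hQ.isExactOn_ball
    have hbd : d < b := by simp only [hbdef]; linarith
    have hbS : b ∈ interior S := interior_maximal hdS isOpen_Ioi hbd
    have hopen : IsOpen {s : ℂ | d < s.re} := isOpen_lt continuous_const Complex.continuous_re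
    have hGd : DifferentiableOn ℂ G {s : ℂ | d < s.re} :=
      differentiableOn_complexMGF.mono fun s hs => interior_maximal hdS isOpen_Ioi hs
    set δ := ρ / 4 with hδdef
    have hδ : 0 < δ := by positivity
    have hsmall1 : Metric.ball (b : ℂ) δ ⊆ Metric.ball (b : ℂ) (ρ / 2) :=
      Metric.ball_subset_ball (by simp only [δ]; linarith)
    have hsmall2 : Metric.ball (b : ℂ) δ ⊆ {s : ℂ | d < s.re} := by
      intro s hs
      have h1 : |(s - b).re| < δ :=
        (Complex.abs_re_le_norm _).trans_lt (by simpa [dist_eq_norm] using hs)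
      have h2 := (abs_lt.1 h1).1
      simp only [Complex.sub_re, Complex.ofReal_re, hbdef] at h2
      simp only [Set.mem_ofPred_eq]
      linarith
    have hconst : Set.EqOn (fun s => s * G s) (fun s => P s + (b * G b - P b))
        (Metric.ball (b : ℂ) δ) := by
      refine Metric.isOpen_ball.eqOn_of_deriv_eq (x := (b : ℂ))
        (convex_ball (b : ℂ) δ).isPreconnected ?_ ?_ ?_ (Metric.mem_ball_self hδ) (by ring)
      · exact differentiableOn_id.mul (hGd.mono hsmall2)
      · exact fun s hs => ((hP s (hsmall1 hs)).add_const _).differentiableAt.differentiableWithinAt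
      · intro s hs
        rw [((hP s (hsmall1 hs)).add_const _).deriv]
        have h1 := hext d hcd.le hdS s (hsmall2 hs)
        have h2 := (hsub (hsmall1 hs)).2
        field_simp
        linear_combination h1
    suffices hmem : b - 3 * ρ / 8 ∈ S by
      have := csInf_le ⟨s₀, hlb⟩ hmem
      linarith
    refine mem_integrableExpSet_of_differentiableOn_ball hY hbS
      (H := fun s => (P s + (b * G b - P b)) / s) (R := ρ / 2) ?_ ?_ (by positivity)
      (by linarith)
    · refine DifferentiableOn.div ?_ differentiableOn_id fun s hs h0 => ?_
      · exact fun s hs => ((hP s hs).add_const _).differentiableAt.differentiableWithinAt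
      · have := (hsub hs).1
        rw [show s = 0 from h0, Complex.zero_re] at this
        linarith
    · filter_upwards [Metric.ball_mem_nhds (b : ℂ) hδ] with s hs
      have h0 : s ≠ 0 := fun h0 => by
        have := hsmall2 hs
        rw [h0] at this
        simp only [Set.mem_ofPred_eq, Complex.zero_re] at this
        linarith
      rw [div_eq_iff h0, mul_comm (complexMGF Y ν s)]
      exact (hconst hs).symm
  exact ⟨hmain, hext c le_rfl hmain⟩

open Filter Topology in
theorem AnalyticAt.tendsto_sub_mul_deriv_div {f : ℂ → ℂ} {z₀ : ℂ} (hf : AnalyticAt ℂ f z₀)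
    (htop : analyticOrderAt f z₀ ≠ ⊤) :
    Tendsto (fun z => (z - z₀) * (deriv f z / f z)) (𝓝[≠] z₀) (𝓝 (analyticOrderNatAt f z₀)) := by
  obtain ⟨g, hg, hg0, hfg⟩ := hf.analyticOrderAt_ne_top.1 htop
  set n := analyticOrderNatAt f z₀
  have hlim : Tendsto (fun z => n + (z - z₀) * (deriv g z / g z)) (𝓝[≠] z₀)
      (𝓝 (n + (z₀ - z₀) * (deriv g z₀ / g z₀))) := by
    refine Tendsto.mono_left (ContinuousAt.tendsto ?_) nhdsWithin_le_nhds
    exact continuousAt_const.add ((continuousAt_id.sub continuousAt_const).mul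
      (hg.deriv.continuousAt.div hg.continuousAt hg0))
  rw [sub_self, zero_mul, add_zero] at hlim
  refine hlim.congr' ?_
  have h1 := hfg.eventually_nhds
  have h2 := hg.eventually_analyticAt
  have h3 := hg.continuousAt.eventually_ne hg0
  filter_upwards [nhdsWithin_le_nhds h1, nhdsWithin_le_nhds h2, nhdsWithin_le_nhds h3,
    self_mem_nhdsWithin] with z h1 h2 h3 h4
  have h4 : z - z₀ ≠ 0 := sub_ne_zero.2 h4
  have hd : deriv f z / f z = n / (z - z₀) + deriv g z / g z := by
    have e1 : logDeriv f z = logDeriv (fun z => (z - z₀) ^ n * g z) z := by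
      have h5 : f =ᶠ[𝓝 z] fun z => (z - z₀) ^ n * g z := h1
      rw [logDeriv_apply, logDeriv_apply, h5.deriv_eq, h5.eq_of_nhds]
    rw [← logDeriv_apply, ← logDeriv_apply, e1,
      logDeriv_mul (f := fun z => (z - z₀) ^ n) _ (pow_ne_zero _ h4) h3 (by fun_prop)
      h2.differentiableAt, logDeriv_fun_pow (by fun_prop)]
    simp [logDeriv_apply, div_eq_mul_inv]
  rw [hd]
  field_simp

open Filter Topology in
theorem ne_zero_of_deriv_eventuallyEq_mul {f k : ℂ → ℂ} {z₀ : ℂ} (hf : AnalyticAt ℂ f z₀)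
    (hk : AnalyticAt ℂ k z₀) (htop : analyticOrderAt f z₀ ≠ ⊤)
    (h : deriv f =ᶠ[𝓝 z₀] fun z => f z * k z) : f z₀ ≠ 0 := by
  intro h0
  have h1 := hf.analyticOrderAt_deriv_add_one
  simp only [h0, sub_zero] at h1
  have h2 : analyticOrderAt (deriv f) z₀ = analyticOrderAt f z₀ + analyticOrderAt k z₀ := by
    rw [analyticOrderAt_congr h]
    exact analyticOrderAt_mul hf hk
  have h3 : analyticOrderAt f z₀ + 1 ≤ analyticOrderAt f z₀ := by
    conv_rhs => rw [← h1, h2]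
    gcongr
    exact le_self_add
  exact absurd (ENat.add_one_le_iff htop |>.1 h3) (lt_irrefl _)

theorem analyticOrderAt_riemannZeta₁_ne_top (s : ℂ) : analyticOrderAt riemannZeta₁ s ≠ ⊤ := by
  intro h
  have h1 : AnalyticOnNhd ℂ riemannZeta₁ Set.univ :=
    differentiable_riemannZeta₁.differentiableOn.analyticOnNhd isOpen_univ
  have h2 := h1.eqOn_zero_of_preconnected_of_eventuallyEq_zero isPreconnected_univ (Set.mem_univ s)
    (analyticOrderAt_eq_top.1 h) (Set.mem_univ 1)
  rw [riemannZeta₁_one] at h2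
  exact one_ne_zero h2

theorem riemannZeta₁_ofReal_ne_zero_of_pos {σ : ℝ} (hσ : 0 < σ) : riemannZeta₁ σ ≠ 0 := by
  rcases le_or_gt σ 1 with h | h
  · exact riemannZeta₁_ofReal_ne_zero hσ h
  · have h1 : (σ : ℂ) ≠ 1 := by exact_mod_cast h.ne'
    rw [riemannZeta₁_eq_sub_one_mul h1]
    exact mul_ne_zero (sub_ne_zero.2 h1)
      (riemannZeta_ne_zero_of_one_lt_re (by simpa using h))

open MeasureTheory ProbabilityTheory in
theorem mgf_le_add_integral_div {Ω : Type*} [MeasurableSpace Ω] {ν : Measure Ω} {Y : Ω → ℝ}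
    (hY : ∀ᵐ ω ∂ν, Y ω ≤ 0) {M s : ℝ} (hM : 0 < M) (hs0 : 0 ≤ s)
    (h2 : 2 ∈ integrableExpSet Y ν) (hs : s ∈ interior (integrableExpSet Y ν)) :
    mgf Y ν s ≤ Real.exp (2 * M) * mgf Y ν 2 + (∫ ω, -Y ω * Real.exp (s * Y ω) ∂ν) / M := by
  have hi1 : Integrable (fun ω => Real.exp (2 * M) * Real.exp (2 * Y ω)) ν := h2.const_mul _
  have hi2 : Integrable (fun ω => -Y ω * Real.exp (s * Y ω) / M) ν := by
    have := ((integrable_pow_mul_exp_of_mem_interior_integrableExpSet hs 1).neg).div_const M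
    simpa using this
  simp only [mgf]
  rw [← integral_const_mul, ← integral_div, ← integral_add hi1 hi2]
  have hi0 : Integrable (fun ω => Real.exp (s * Y ω)) ν :=
    integrable_of_mem_integrableExpSet (interior_subset hs)
  refine integral_mono_ae hi0 (hi1.add hi2) ?_
  filter_upwards [hY] with ω hω
  rcases le_or_gt M (-Y ω) with h | h
  · have : Real.exp (s * Y ω) ≤ -Y ω * Real.exp (s * Y ω) / M := by
      rw [le_div_iff₀ hM, mul_comm]
      gcongr
    have := Real.exp_pos (2 * M)
    have := Real.exp_pos (2 * Y ω)
    nlinarith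
  · have h1 : Real.exp (s * Y ω) ≤ Real.exp (2 * M) * Real.exp (2 * Y ω) := by
      rw [← Real.exp_add]
      gcongr
      nlinarith
    have h2 : 0 ≤ -Y ω * Real.exp (s * Y ω) / M := by
      have : 0 ≤ -Y ω := by linarith
      positivity
    linarith

open MeasureTheory ProbabilityTheory Complex in
theorem re_sum_sum_integral_mul_div_nonneg {Ω : Type*} [MeasurableSpace Ω] {ν : Measure Ω}
    {Y : Ω → ℝ} (hY : ∀ᵐ ω ∂ν, Y ω ≤ 0) {s : ℝ} (hs : s ∈ interior (integrableExpSet Y ν))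
    (F : Finset ℝ) {x : ℝ} (hx : 0 < x) :
    0 ≤ (∑ a ∈ F, ∑ b ∈ F, (∫ ω, -(Y ω : ℂ) * cexp ((s + (a - b : ℝ) * I) * Y ω) ∂ν) *
      ((x : ℂ) / (x + (a - b : ℝ) * I))).re := by
  have hi : ∀ a b : ℝ, Integrable (fun ω => -(Y ω : ℂ) * cexp ((s + (a - b : ℝ) * I) * Y ω) *
      ((x : ℂ) / (x + (a - b : ℝ) * I))) ν := by
    intro a b
    have := (integrable_pow_mul_cexp_of_re_mem_interior_integrableExpSet
      (z := s + (a - b : ℝ) * I) (by simpa using hs) 1).neg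
    simpa using this.mul_const _
  simp_rw [← integral_mul_const]
  have h1 : ∀ a ∈ F, ∑ b ∈ F, ∫ ω, -(Y ω : ℂ) * cexp ((s + (a - b : ℝ) * I) * Y ω) *
      ((x : ℂ) / (x + (a - b : ℝ) * I)) ∂ν = ∫ ω, ∑ b ∈ F, -(Y ω : ℂ) *
      cexp ((s + (a - b : ℝ) * I) * Y ω) * ((x : ℂ) / (x + (a - b : ℝ) * I)) ∂ν := fun a _ =>
    (integral_finsetSum _ fun b _ => hi a b).symm
  rw [Finset.sum_congr rfl h1, ← integral_finsetSum _ fun a _ => integrable_finsetSum _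
    fun b _ => hi a b, ← RCLike.re_eq_complex_re,
    ← integral_re (integrable_finsetSum _ fun a _ => integrable_finsetSum _ fun b _ => hi a b)]
  refine integral_nonneg_of_ae ?_
  filter_upwards [hY] with ω hω
  have h2 : ∑ a ∈ F, ∑ b ∈ F, -(Y ω : ℂ) * cexp ((s + (a - b : ℝ) * I) * Y ω) *
      ((x : ℂ) / (x + (a - b : ℝ) * I)) = ((-Y ω * Real.exp (s * Y ω) : ℝ) : ℂ) *
      ∑ a ∈ F, ∑ b ∈ F, cexp ((a * Y ω : ℝ) * I) * starRingEnd ℂ (cexp ((b * Y ω : ℝ) * I)) *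
        ((x : ℂ) / (x + (a - b : ℝ) * I)) := by
    simp_rw [Finset.mul_sum]
    refine Finset.sum_congr rfl fun a _ => Finset.sum_congr rfl fun b _ => ?_
    have h3 : cexp ((s + (a - b : ℝ) * I) * Y ω) = cexp (s * Y ω) *
        (cexp ((a * Y ω : ℝ) * I) * starRingEnd ℂ (cexp ((b * Y ω : ℝ) * I))) := by
      rw [← exp_conj, ← exp_add, ← exp_add]
      congr 1
      simp
      ring
    rw [h3]
    push_cast
    ring
  rw [Pi.zero_apply, h2, RCLike.re_eq_complex_re, re_ofReal_mul]
  have h4 : 0 ≤ -Y ω := by linarith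
  have := re_sum_sum_div_nonneg hx F fun a => cexp ((a * Y ω : ℝ) * I)
  positivity

open MeasureTheory ProbabilityTheory Complex Filter Topology in
/-- The Laplace transform of a positive measure is negligible, near a singular abscissa,
with respect to its derivative. -/
theorem tendsto_mul_mgf_of_tendsto {Ω : Type*} [MeasurableSpace Ω] {ν : Measure Ω} {Y : Ω → ℝ}
    (hY : ∀ᵐ ω ∂ν, Y ω ≤ 0) (hS : Set.Ioi (1 / 2) ⊆ integrableExpSet Y ν) {L : ℝ}
    (hL : Tendsto (fun σ : ℝ => σ * ((1 / 2 + σ) * (∫ ω, -Y ω * Real.exp ((1 / 2 + σ) * Y ω) ∂ν) -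
      mgf Y ν (1 / 2 + σ))) (𝓝[>] 0) (𝓝 L)) :
    Tendsto (fun σ : ℝ => σ * mgf Y ν (1 / 2 + σ)) (𝓝[>] 0) (𝓝 0) := by
  set D : ℝ → ℝ := fun s => ∫ ω, -Y ω * Real.exp (s * Y ω) ∂ν with hD
  have hle : ∀ M > 0, ∀ σ > 0,
      mgf Y ν (1 / 2 + σ) ≤ Real.exp (2 * M) * mgf Y ν 2 + D (1 / 2 + σ) / M := fun M hM σ hσ =>
    mgf_le_add_integral_div hY hM (by linarith) (hS (by norm_num))
      (interior_maximal hS isOpen_Ioi (by simpa using hσ))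
  set g := mgf Y ν 2
  have hg : 0 ≤ g := mgf_nonneg
  set K := 4 * (L + 1 + Real.exp (2 * 4) * g)
  have hpos : ∀ᶠ σ : ℝ in 𝓝[>] 0, 0 < σ := self_mem_nhdsWithin
  have hlt : ∀ δ > 0, ∀ᶠ σ : ℝ in 𝓝[>] 0, σ < δ := fun δ hδ =>
    nhdsWithin_le_nhds (eventually_lt_nhds hδ)
  have hK : ∀ᶠ σ : ℝ in 𝓝[>] 0, σ * D (1 / 2 + σ) ≤ K := by
    filter_upwards [hpos, hlt 1 one_pos, hL.eventually_lt_const (lt_add_one L)] with σ h0 h1 h2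
    have h3 := hle 4 (by norm_num) σ h0
    have hD0 : 0 ≤ D (1 / 2 + σ) := by
      refine integral_nonneg_of_ae ?_
      filter_upwards [hY] with ω hω
      have : 0 ≤ -Y ω := by linarith
      positivity
    have h4 : D (1 / 2 + σ) / 4 - Real.exp (2 * 4) * g ≤
        (1 / 2 + σ) * D (1 / 2 + σ) - mgf Y ν (1 / 2 + σ) := by nlinarith
    have h5 := mul_le_mul_of_nonneg_left h4 h0.le
    have h6 : σ * (Real.exp (2 * 4) * g) ≤ Real.exp (2 * 4) * g :=
      mul_le_of_le_one_left (by positivity) h1.le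
    have h7 : σ * ((1 / 2 + σ) * D (1 / 2 + σ) - mgf Y ν (1 / 2 + σ)) < L + 1 := h2
    have key : ∀ d e : ℝ, σ * (d / 4 - e) ≤ L + 1 → σ * e ≤ e → σ * d ≤ 4 * (L + 1 + e) := by
      intro d e h h'
      linarith
    exact key _ _ (h5.trans h7.le) h6
  rw [Metric.tendsto_nhds]
  intro η hη
  set M := 2 * (|K| + 1) / η with hMdef
  have hM : 0 < M := by positivity
  set δ := η / (2 * (Real.exp (2 * M) * g + 1)) with hδdef
  have hδ : 0 < δ := by positivity
  filter_upwards [hpos, hlt δ hδ, hK] with σ h0 h1 h2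
  have h3 := mul_le_mul_of_nonneg_left (hle M hM σ h0) h0.le
  have h4 : σ * (Real.exp (2 * M) * g) < η / 2 := by
    have h5 : σ * (2 * (Real.exp (2 * M) * g + 1)) < η := (lt_div_iff₀ (by positivity)).1 h1
    nlinarith
  have h6 : σ * D (1 / 2 + σ) / M ≤ η / 2 := by
    rw [div_le_iff₀ hM, hMdef]
    have : η / 2 * (2 * (|K| + 1) / η) = |K| + 1 := by field_simp
    rw [this]
    linarith [le_abs_self K]
  have h7 : 0 ≤ mgf Y ν (1 / 2 + σ) := mgf_nonneg
  rw [Real.dist_eq, sub_zero, abs_of_nonneg (by positivity)]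
  calc _ ≤ _ := h3
    _ = σ * (Real.exp (2 * M) * g) + σ * D (1 / 2 + σ) / M := by ring
    _ < η := by linarith

open MeasureTheory ProbabilityTheory Complex Filter Topology in
theorem not_forall_riemannZeta₁_mul_deriv_complexMGF_eq {Ω : Type*} [MeasurableSpace Ω]
    {ν : Measure Ω} {Y : Ω → ℝ} (hY : ∀ᵐ ω ∂ν, Y ω ≤ 0) (hS : Set.Ioi 1 ⊆ integrableExpSet Y ν)
    {ε : ℝ} (hε : ε = 1 ∨ ε = -1) {h : ℂ → ℂ} (hh : DifferentiableOn ℂ h {s | 1 / 2 < s.re})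
    (hlim : ∀ γ : ℝ, Tendsto (fun σ : ℝ => σ * h (1 / 2 + γ * I + σ)) (𝓝[>] 0)
      (𝓝 (if γ = 0 then ε / 2 else 0))) :
    ¬ ∀ s : ℂ, 1 < s.re → riemannZeta₁ s * deriv (fun s => s * complexMGF Y ν s) s +
      (ε * deriv riemannZeta₁ s + h s * riemannZeta₁ s) = 0 := by
  intro heq
  have hZ := differentiable_riemannZeta₁
  have hε0 : (ε : ℂ) ≠ 0 := by rcases hε with rfl | rfl <;> simp
  have hopen : IsOpen {s : ℂ | 1 / 2 < s.re} := isOpen_lt continuous_const continuous_re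
  have hZd : Differentiable ℂ (deriv riemannZeta₁) := fun s =>
    (hZ.analyticAt s).deriv.differentiableAt
  obtain ⟨hS, heq⟩ := Ioi_subset_integrableExpSet_of_mul_deriv_add_eq_zero hY
    (c := 1 / 2) (by norm_num) hS hZ
    (((hZd.const_mul (ε : ℂ)).differentiableOn).add (hh.mul hZ.differentiableOn))
    (fun σ hσ => riemannZeta₁_ofReal_ne_zero_of_pos (by linarith)) heq
  simp only [Pi.add_apply, Pi.mul_apply] at heq
  have hSi : ∀ s : ℂ, 1 / 2 < s.re → s.re ∈ interior (integrableExpSet Y ν) := fun s hs =>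
    interior_maximal hS isOpen_Ioi hs
  have hG : DifferentiableOn ℂ (complexMGF Y ν) {s | 1 / 2 < s.re} :=
    differentiableOn_complexMGF.mono hSi
  have hRH : ∀ s : ℂ, 1 / 2 < s.re → riemannZeta₁ s ≠ 0 := by
    intro s hs
    have hk : DifferentiableOn ℂ
        (fun s => -(deriv (fun s => s * complexMGF Y ν s) s + h s) / ε) {s | 1 / 2 < s.re} :=
      (((differentiableOn_id.mul hG).deriv hopen).add hh).neg.div_const _
    refine ne_zero_of_deriv_eventuallyEq_mul (hZ.analyticAt s)
      (hk.analyticAt (hopen.mem_nhds hs)) (analyticOrderAt_riemannZeta₁_ne_top s) ?_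
    filter_upwards [hopen.mem_nhds hs] with z hz
    have := heq z hz
    field_simp
    linear_combination this
  set D : ℂ → ℂ := fun s => ∫ ω, -(Y ω : ℂ) * cexp (s * Y ω) ∂ν with hD
  have hderiv : ∀ s : ℂ, 1 / 2 < s.re → deriv (complexMGF Y ν) s = -D s := by
    intro s hs
    rw [(hasDerivAt_complexMGF (hSi s hs)).deriv, hD, ← integral_neg]
    simp
  have hDG : ∀ s : ℂ, 1 / 2 < s.re →
      s * D s - complexMGF Y ν s = ε * (deriv riemannZeta₁ s / riemannZeta₁ s) + h s := by
    intro s hs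
    have h1 := heq s hs
    have h2 := hRH s hs
    rw [deriv_id_mul_eq (hG.differentiableAt (hopen.mem_nhds hs)), hderiv s hs] at h1
    field_simp
    linear_combination -h1
  set m : ℝ → ℕ := fun γ => analyticOrderNatAt riemannZeta₁ (1 / 2 + γ * I) with hm
  set L : ℝ → ℂ := fun γ => ε * m γ + if γ = 0 then (ε : ℂ) / 2 else 0 with hL
  have hpos : ∀ᶠ σ : ℝ in 𝓝[>] 0, 0 < σ := self_mem_nhdsWithin
  have hlimL : ∀ γ : ℝ, Tendsto (fun σ : ℝ => (σ : ℂ) * ((1 / 2 + γ * I + σ) *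
      D (1 / 2 + γ * I + σ) - complexMGF Y ν (1 / 2 + γ * I + σ))) (𝓝[>] 0) (𝓝 (L γ)) := by
    intro γ
    have h1 := (hZ.analyticAt (1 / 2 + γ * I)).tendsto_sub_mul_deriv_div
      (analyticOrderAt_riemannZeta₁_ne_top _)
    have h2 : Tendsto (fun σ : ℝ => 1 / 2 + γ * I + (σ : ℂ)) (𝓝[>] 0) (𝓝[≠] (1 / 2 + γ * I)) := by
      refine tendsto_nhdsWithin_iff.2 ⟨?_, ?_⟩
      · have : ContinuousAt (fun σ : ℝ => 1 / 2 + γ * I + (σ : ℂ)) 0 := by fun_prop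
        simpa using this.tendsto.mono_left nhdsWithin_le_nhds
      · filter_upwards [hpos] with σ hσ
        simpa using hσ.ne'
    have h3 := ((h1.comp h2).const_mul (ε : ℂ)).add (hlim γ)
    refine h3.congr' ?_
    filter_upwards [hpos] with σ hσ
    rw [hDG _ (by simpa using hσ)]
    simp only [Function.comp_apply]
    ring
  have hm0 : m 0 = 0 := by
    have h1 : riemannZeta₁ (1 / 2 + (0 : ℝ) * I) ≠ 0 := by
      have := riemannZeta₁_ofReal_ne_zero_of_pos (σ := 1 / 2) (by norm_num)
      simpa using this
    simp only [hm, analyticOrderNatAt, ((hZ.analyticAt _).analyticOrderAt_eq_zero).2 h1]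
    rfl
  have hDreal : ∀ s : ℝ, D s = ((∫ ω, -Y ω * Real.exp (s * Y ω) ∂ν : ℝ) : ℂ) := by
    intro s
    rw [← integral_complex_ofReal, hD]
    simp
  have hmgf : Tendsto (fun σ : ℝ => σ * mgf Y ν (1 / 2 + σ)) (𝓝[>] 0) (𝓝 0) := by
    refine tendsto_mul_mgf_of_tendsto hY hS (L := (L 0).re) ?_
    refine ((continuous_re.tendsto _).comp (hlimL 0)).congr fun σ => ?_
    have h1 : (1 / 2 + (0 : ℝ) * I + σ : ℂ) = ((1 / 2 + σ : ℝ) : ℂ) := by push_cast; ring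
    rw [Function.comp_apply, h1, hDreal, complexMGF_ofReal]
    norm_cast
  have hlimD : ∀ γ : ℝ, Tendsto (fun σ : ℝ => (σ : ℂ) * D (1 / 2 + γ * I + σ)) (𝓝[>] 0)
      (𝓝 (L γ / (1 / 2 + γ * I))) := by
    intro γ
    have h1 : Tendsto (fun σ : ℝ => (σ : ℂ) * complexMGF Y ν (1 / 2 + γ * I + σ)) (𝓝[>] 0)
        (𝓝 0) := by
      refine squeeze_zero_norm' ?_ hmgf
      filter_upwards [hpos] with σ hσ
      rw [norm_mul, norm_real, Real.norm_of_nonneg hσ.le]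
      gcongr
      simpa using norm_complexMGF_le_mgf (X := Y) (μ := ν) (z := 1 / 2 + γ * I + σ)
    have hre : ∀ σ : ℝ, 0 ≤ σ → (1 / 2 + γ * I + σ : ℂ) ≠ 0 := by
      intro σ hσ h0
      have := congrArg re h0
      simp at this
      linarith
    have h2 : Tendsto (fun σ : ℝ => 1 / 2 + γ * I + (σ : ℂ)) (𝓝[>] 0) (𝓝 (1 / 2 + γ * I)) := by
      have : ContinuousAt (fun σ : ℝ => 1 / 2 + γ * I + (σ : ℂ)) 0 := by fun_prop
      simpa using this.tendsto.mono_left nhdsWithin_le_nhds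
    have h3 := ((hlimL γ).add h1).div h2 (by simpa using hre 0 le_rfl)
    rw [add_zero] at h3
    refine h3.congr' ?_
    filter_upwards [hpos] with σ hσ
    rw [Pi.div_apply, div_eq_iff (hre σ hσ.le)]
    ring
  have hr0 : L 0 / (1 / 2 + (0 : ℝ) * I) = ε := by
    simp [hL, hm0]
  have hε1 : ε = 1 := by
    have h1 : 0 ≤ ε := by
      have h2 := (continuous_re.tendsto _).comp (hlimD 0)
      rw [hr0, ofReal_re] at h2
      refine ge_of_tendsto h2 ?_
      filter_upwards [hpos] with σ hσ
      have h1 : (1 / 2 + (0 : ℝ) * I + σ : ℂ) = ((1 / 2 + σ : ℝ) : ℂ) := by push_cast; ring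
      rw [Function.comp_apply, h1, hDreal, ← ofReal_mul, ofReal_re]
      refine mul_nonneg hσ.le (integral_nonneg_of_ae ?_)
      filter_upwards [hY] with ω hω
      have : 0 ≤ -Y ω := by linarith
      positivity
    rcases hε with h2 | h2
    · exact h2
    · linarith
  obtain ⟨F, x, hx, hneg⟩ := exists_sum_sub_neg_of_riemannZeta₁_ne_zero hRH
    (r := fun γ => L γ / (1 / 2 + γ * I)) (by rw [hr0, hε1, ofReal_one])
    (fun γ hγ => by simp [hL, hγ, hε1, hm])
  refine hneg.not_ge ?_
  have hsum : Tendsto (fun σ : ℝ => (∑ a ∈ F, ∑ b ∈ F, (σ : ℂ) *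
      D (1 / 2 + (a - b : ℝ) * I + σ) * ((x : ℂ) / (x + (a - b : ℝ) * I))).re) (𝓝[>] 0)
      (𝓝 (∑ a ∈ F, ∑ b ∈ F, L (a - b) / (1 / 2 + (a - b : ℝ) * I) *
        ((x : ℂ) / (x + (a - b : ℝ) * I))).re) := by
    refine (continuous_re.tendsto _).comp ?_
    exact tendsto_finsetSum _ fun a _ => tendsto_finsetSum _ fun b _ =>
      (hlimD (a - b)).mul_const _
  refine ge_of_tendsto hsum ?_
  filter_upwards [hpos] with σ hσ
  have h1 := re_sum_sum_integral_mul_div_nonneg hY (s := 1 / 2 + σ)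
    (interior_maximal hS isOpen_Ioi (by simpa using hσ)) F hx
  have h2 : ∑ a ∈ F, ∑ b ∈ F, (σ : ℂ) * D (1 / 2 + (a - b : ℝ) * I + σ) *
      ((x : ℂ) / (x + (a - b : ℝ) * I)) = (σ : ℂ) * ∑ a ∈ F, ∑ b ∈ F,
      (∫ ω, -(Y ω : ℂ) * cexp (((1 / 2 + σ : ℝ) + (a - b : ℝ) * I) * Y ω) ∂ν) *
      ((x : ℂ) / (x + (a - b : ℝ) * I)) := by
    simp_rw [Finset.mul_sum]
    refine Finset.sum_congr rfl fun a _ => Finset.sum_congr rfl fun b _ => ?_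
    have h3 : (1 / 2 + (a - b : ℝ) * I + σ : ℂ) = (1 / 2 + σ : ℝ) + (a - b : ℝ) * I := by
      push_cast; ring
    rw [h3, hD, mul_assoc]
  rw [h2, re_ofReal_mul]
  positivity

theorem summable_log_mul_rpow_neg_primes {a : ℝ} (ha : 1 < a) :
    Summable fun p : Nat.Primes => Real.log p * (p : ℝ) ^ (-a) := by
  have h := (ArithmeticFunction.LSeriesSummable_vonMangoldt (s := (a : ℂ)) (by simpa using ha)).norm
  refine (h.comp_injective Nat.Primes.coe_nat_injective).congr fun p => ?_
  have hp : 0 ≤ Real.log p := Real.log_natCast_nonneg _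
  simp only [Function.comp_apply, LSeries.norm_term_eq, p.prop.ne_zero, if_false,
    ArithmeticFunction.vonMangoldt_apply_prime p.prop, Complex.norm_real, Real.norm_of_nonneg hp,
    Complex.ofReal_re]
  rw [Real.rpow_neg (Nat.cast_nonneg _), div_eq_mul_inv]

/-- The Dirichlet series `∑ log p / p ^ s` over primes. -/
noncomputable def primeLogSeries (s : ℂ) : ℂ :=
  ∑' p : Nat.Primes, (Real.log p : ℂ) * (p : ℂ) ^ (-s)

/-- The contribution of the third and higher prime powers to the series of the von Mangoldt
function. -/
noncomputable def primeLogCubeSeries (s : ℂ) : ℂ :=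
  ∑' p : Nat.Primes, (Real.log p : ℂ) * ((p : ℂ) ^ (-s)) ^ 3 / (1 - (p : ℂ) ^ (-s))

theorem norm_prime_cpow_neg (p : Nat.Primes) (s : ℂ) : ‖(p : ℂ) ^ (-s)‖ = (p : ℝ) ^ (-s.re) := by
  rw [Complex.norm_natCast_cpow_of_pos p.prop.pos, Complex.neg_re]

theorem one_sub_le_norm_one_sub_prime_cpow_neg {a : ℝ} (ha : 0 < a) {s : ℂ} (hs : a ≤ s.re)
    (p : Nat.Primes) : 1 - (2 : ℝ) ^ (-a) ≤ ‖1 - (p : ℂ) ^ (-s)‖ := by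
  have hp : (2 : ℝ) ≤ p := by exact_mod_cast p.prop.two_le
  have h1 : ‖(p : ℂ) ^ (-s)‖ ≤ (2 : ℝ) ^ (-a) := by
    rw [norm_prime_cpow_neg]
    calc (p : ℝ) ^ (-s.re) ≤ (p : ℝ) ^ (-a) := by gcongr; linarith
      _ ≤ 2 ^ (-a) := Real.rpow_le_rpow_of_nonpos (by norm_num) hp (by linarith)
  have h2 := norm_sub_norm_le (1 : ℂ) ((p : ℂ) ^ (-s))
  rw [norm_one] at h2
  linarith

theorem one_sub_two_rpow_neg_pos {a : ℝ} (ha : 0 < a) : 0 < 1 - (2 : ℝ) ^ (-a) :=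
  sub_pos.2 (Real.rpow_lt_one_of_one_lt_of_neg one_lt_two (by linarith))

theorem norm_log_mul_prime_cpow_neg_le {a : ℝ} {s : ℂ} (hs : a ≤ s.re) (p : Nat.Primes) :
    ‖(Real.log p : ℂ) * (p : ℂ) ^ (-s)‖ ≤ Real.log p * (p : ℝ) ^ (-a) := by
  have hp : (1 : ℝ) ≤ p := by exact_mod_cast p.prop.one_le
  have h0 : 0 ≤ Real.log p := Real.log_natCast_nonneg _
  rw [norm_mul, norm_prime_cpow_neg, Complex.norm_real, Real.norm_of_nonneg h0]
  gcongr

theorem norm_log_mul_prime_cpow_neg_cube_div_le {a : ℝ} (ha : 0 < a) {s : ℂ} (hs : a ≤ s.re)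
    (p : Nat.Primes) :
    ‖(Real.log p : ℂ) * ((p : ℂ) ^ (-s)) ^ 3 / (1 - (p : ℂ) ^ (-s))‖ ≤
      Real.log p * (p : ℝ) ^ (-(3 * a)) * (1 - (2 : ℝ) ^ (-a))⁻¹ := by
  have hp : (1 : ℝ) ≤ p := by exact_mod_cast p.prop.one_le
  have h0 : 0 ≤ Real.log p := Real.log_natCast_nonneg _
  have h1 := one_sub_two_rpow_neg_pos ha
  have h2 := one_sub_le_norm_one_sub_prime_cpow_neg ha hs p
  rw [norm_div, norm_mul, norm_pow, norm_prime_cpow_neg, Complex.norm_real,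
    Real.norm_of_nonneg h0, div_eq_mul_inv, ← Real.rpow_mul_natCast (by linarith)]
  gcongr
  push_cast
  linarith

theorem differentiableAt_primeLogSeries {s : ℂ} (hs : 1 < s.re) :
    DifferentiableAt ℂ primeLogSeries s := by
  obtain ⟨a, ha, has⟩ := exists_between hs
  have hopen : IsOpen {s : ℂ | a < s.re} := isOpen_lt continuous_const Complex.continuous_re
  refine (Complex.differentiableOn_tsum_of_summable_norm (summable_log_mul_rpow_neg_primes ha)
    (fun p => ?_) hopen fun p w hw => norm_log_mul_prime_cpow_neg_le (le_of_lt hw) p).differentiableAt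
    (hopen.mem_nhds has)
  have : (p : ℂ) ≠ 0 := by exact_mod_cast p.prop.ne_zero
  exact fun w _ => ((differentiableAt_id.neg.const_cpow (Or.inl this)).const_mul
    _).differentiableWithinAt

theorem differentiableAt_primeLogCubeSeries {s : ℂ} (hs : 1 / 3 < s.re) :
    DifferentiableAt ℂ primeLogCubeSeries s := by
  obtain ⟨a, ha, has⟩ := exists_between hs
  have ha0 : 0 < a := by linarith
  have hopen : IsOpen {s : ℂ | a < s.re} := isOpen_lt continuous_const Complex.continuous_re
  refine (Complex.differentiableOn_tsum_of_summable_norm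
    ((summable_log_mul_rpow_neg_primes (a := 3 * a) (by linarith)).mul_right _)
    (fun p => ?_) hopen fun p w hw => norm_log_mul_prime_cpow_neg_cube_div_le ha0
      (le_of_lt hw) p).differentiableAt (hopen.mem_nhds has)
  have hp : (p : ℂ) ≠ 0 := by exact_mod_cast p.prop.ne_zero
  intro w hw
  have h1 : DifferentiableAt ℂ (fun w : ℂ => (p : ℂ) ^ (-w)) w :=
    differentiableAt_id.neg.const_cpow (Or.inl hp)
  refine DifferentiableAt.differentiableWithinAt (((h1.pow 3).const_mul _).div (h1.const_sub 1) ?_)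
  rw [← norm_pos_iff]
  exact (one_sub_two_rpow_neg_pos ha0).trans_le
    (one_sub_le_norm_one_sub_prime_cpow_neg ha0 (le_of_lt hw) p)

theorem natCast_pow_cpow (n k : ℕ) (s : ℂ) : ((n ^ k : ℕ) : ℂ) ^ s = ((n : ℂ) ^ s) ^ k := by
  induction k with
  | zero => simp
  | succ k ih => rw [pow_succ, Nat.cast_mul, Complex.natCast_mul_natCast_cpow, ih, pow_succ]

theorem neg_deriv_riemannZeta_div_eq {s : ℂ} (hs : 1 < s.re) :
    -deriv riemannZeta s / riemannZeta s =
      primeLogSeries s + primeLogSeries (2 * s) + primeLogCubeSeries s := by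
  have hsum := ArithmeticFunction.LSeriesSummable_vonMangoldt hs
  rw [← ArithmeticFunction.LSeries_vonMangoldt_eq_deriv_riemannZeta_div hs, LSeries,
    tsum_eq_tsum_primes_of_support_subset_prime_powers hsum]
  · have hre_two : 1 < (2 * s).re := by simp; linarith
    have s1 : Summable fun p : Nat.Primes => (Real.log p : ℂ) * (p : ℂ) ^ (-s) :=
      Summable.of_norm_bounded (summable_log_mul_rpow_neg_primes hs)
        fun p => norm_log_mul_prime_cpow_neg_le le_rfl p
    have s2 : Summable fun p : Nat.Primes => (Real.log p : ℂ) * (p : ℂ) ^ (-(2 * s)) :=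
      Summable.of_norm_bounded (summable_log_mul_rpow_neg_primes hre_two)
        fun p => norm_log_mul_prime_cpow_neg_le le_rfl p
    have s3 : Summable fun p : Nat.Primes =>
        (Real.log p : ℂ) * ((p : ℂ) ^ (-s)) ^ 3 / (1 - (p : ℂ) ^ (-s)) :=
      Summable.of_norm_bounded ((summable_log_mul_rpow_neg_primes (a := 3 * s.re)
        (by linarith)).mul_right _)
        fun p => norm_log_mul_prime_cpow_neg_cube_div_le (by linarith) le_rfl p
    rw [primeLogSeries, primeLogSeries, primeLogCubeSeries, ← s1.tsum_add s2,
      ← (s1.add s2).tsum_add s3]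
    refine tsum_congr fun p => ?_
    have hp : (p : ℂ) ≠ 0 := by exact_mod_cast p.prop.ne_zero
    set q := (p : ℂ) ^ (-s) with hq
    have hlt : ‖q‖ < 1 := by
      rw [hq, norm_prime_cpow_neg]
      exact Real.rpow_lt_one_of_one_lt_of_neg (by exact_mod_cast p.prop.one_lt) (by linarith)
    have hq_ne : 1 - q ≠ 0 := fun h => by
      rw [← sub_eq_zero.1 h, norm_one] at hlt
      exact lt_irrefl _ hlt
    have hterm : ∀ k : ℕ, LSeries.term (fun n => (ArithmeticFunction.vonMangoldt n : ℂ)) s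
        ((p : ℕ) ^ (k + 1)) = (Real.log p : ℂ) * q * q ^ k := by
      intro k
      rw [LSeries.term_of_ne_zero (pow_ne_zero _ p.prop.ne_zero),
        ArithmeticFunction.vonMangoldt_apply_pow k.succ_ne_zero,
        ArithmeticFunction.vonMangoldt_apply_prime p.prop, mul_assoc, ← pow_succ', div_eq_mul_inv,
        ← Complex.cpow_neg]
      congr 1
      rw [hq, natCast_pow_cpow]
    have hsq : (p : ℂ) ^ (-(2 * s)) = q ^ 2 := by
      rw [hq, ← Complex.cpow_nat_mul]
      congr 1
      push_cast
      ring
    rw [tsum_congr hterm, tsum_mul_left, tsum_geometric_of_norm_lt_one hlt, hsq]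
    field_simp
    ring
  · intro n hn
    by_contra h
    refine hn ?_
    have h0 := ArithmeticFunction.vonMangoldt_eq_zero_iff.2 h
    simp [LSeries.term, h0]

open Filter Topology Complex in
theorem riemannZeta₁_ne_zero_of_one_le_re {s : ℂ} (hs : 1 ≤ s.re) : riemannZeta₁ s ≠ 0 := by
  rcases eq_or_ne s 1 with rfl | h1
  · simp [riemannZeta₁_one]
  · rw [riemannZeta₁_eq_sub_one_mul h1]
    exact mul_ne_zero (sub_ne_zero.2 h1) (riemannZeta_ne_zero_of_one_le_re hs)

open Filter Topology in
theorem logDeriv_riemannZeta₁_eq {s : ℂ} (hs : 1 < s.re) :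
    deriv riemannZeta₁ s / riemannZeta₁ s =
      1 / (s - 1) - (primeLogSeries s + primeLogSeries (2 * s) + primeLogCubeSeries s) := by
  have h1 : s ≠ 1 := fun h => by simp [h] at hs
  have h1' : s - 1 ≠ 0 := sub_ne_zero.2 h1
  have hz : riemannZeta s ≠ 0 := riemannZeta_ne_zero_of_one_le_re hs.le
  have heq : riemannZeta₁ =ᶠ[𝓝 s] fun s => (s - 1) * riemannZeta s := by
    filter_upwards [isOpen_ne.mem_nhds h1] with w hw using riemannZeta₁_eq_sub_one_mul hw
  have hd := ((hasDerivAt_id s).sub_const 1).mul (differentiableAt_riemannZeta h1).hasDerivAt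
  rw [heq.deriv_eq, (show deriv (fun s => (s - 1) * riemannZeta s) s = _ from hd.deriv),
    riemannZeta₁_eq_sub_one_mul h1, ← neg_deriv_riemannZeta_div_eq hs]
  simp only [id]
  field_simp
  ring

open Filter Topology Complex in
theorem tendsto_mul_primeLogSeries_two_mul (γ : ℝ) :
    Tendsto (fun σ : ℝ => σ * primeLogSeries (2 * (1 / 2 + γ * I + σ))) (𝓝[>] 0)
      (𝓝 (if γ = 0 then 1 / 2 else 0)) := by
  set w : ℝ → ℂ := fun σ => 2 * (1 / 2 + γ * I + σ) with hw
  have hwc : Continuous w := by fun_prop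
  have hw0 : (w 0).re = 1 := by simp [hw]
  set F : ℂ → ℂ := fun s =>
    deriv riemannZeta₁ s / riemannZeta₁ s + (primeLogSeries (2 * s) + primeLogCubeSeries s) with hF
  have hFc : ContinuousAt F (w 0) := by
    refine ContinuousAt.add (ContinuousAt.div ?_ ?_ ?_) (ContinuousAt.add ?_ ?_)
    · exact (differentiable_riemannZeta₁.analyticAt _).deriv.continuousAt
    · exact differentiable_riemannZeta₁.continuous.continuousAt
    · exact riemannZeta₁_ne_zero_of_one_le_re hw0.ge
    · refine ContinuousAt.comp (f := fun s : ℂ => 2 * s)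
        (differentiableAt_primeLogSeries ?_).continuousAt (by fun_prop)
      simp [hw0]
    · exact (differentiableAt_primeLogCubeSeries (by rw [hw0]; norm_num)).continuousAt
  have h2 : Tendsto (fun σ : ℝ => (σ : ℂ) * F (w σ)) (𝓝[>] 0) (𝓝 0) := by
    have h : ContinuousAt (fun σ : ℝ => (σ : ℂ) * F (w σ)) 0 :=
      continuous_ofReal.continuousAt.mul (ContinuousAt.comp hFc hwc.continuousAt)
    simpa using h.tendsto.mono_left nhdsWithin_le_nhds
  have h1 : Tendsto (fun σ : ℝ => (σ : ℂ) / (w σ - 1)) (𝓝[>] 0)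
      (𝓝 (if γ = 0 then 1 / 2 else 0)) := by
    split_ifs with hγ
    · refine tendsto_const_nhds.congr' ?_
      filter_upwards [self_mem_nhdsWithin] with σ (hσ : 0 < σ)
      have : (σ : ℂ) ≠ 0 := by exact_mod_cast hσ.ne'
      simp only [hw, hγ]
      push_cast
      field_simp
      ring
    · have h : ContinuousAt (fun σ : ℝ => (σ : ℂ) / (w σ - 1)) 0 := by
        refine continuous_ofReal.continuousAt.div (by fun_prop) ?_
        intro h0
        have := congrArg Complex.im h0
        simp [hw] at this
        exact hγ this
      simpa using h.tendsto.mono_left nhdsWithin_le_nhds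
  have h3 := h1.sub h2
  rw [sub_zero] at h3
  refine h3.congr' ?_
  filter_upwards [self_mem_nhdsWithin] with σ (hσ : 0 < σ)
  have hre : 1 < (w σ).re := by simp [hw]; linarith
  simp only [hF, logDeriv_riemannZeta₁_eq hre]
  ring

open Filter Topology Complex in
theorem tendsto_mul_primeLogSeries_add_primeLogCubeSeries (γ : ℝ) :
    Tendsto (fun σ : ℝ => (σ : ℂ) * (primeLogSeries (2 * (1 / 2 + γ * I + σ)) +
      primeLogCubeSeries (1 / 2 + γ * I + σ))) (𝓝[>] 0) (𝓝 (if γ = 0 then 1 / 2 else 0)) := by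
  have h : ContinuousAt (fun σ : ℝ => (σ : ℂ) * primeLogCubeSeries (1 / 2 + γ * I + σ)) 0 := by
    refine continuous_ofReal.continuousAt.mul
      (ContinuousAt.comp (f := fun σ : ℝ => (1 / 2 + γ * I + σ : ℂ)) (g := primeLogCubeSeries)
      (differentiableAt_primeLogCubeSeries ?_).continuousAt (by fun_prop))
    norm_num
  have h0 := h.tendsto.mono_left (nhdsWithin_le_nhds (s := Set.Ioi 0))
  rw [ofReal_zero, zero_mul] at h0
  simpa [mul_add] using (tendsto_mul_primeLogSeries_two_mul γ).add h0

theorem differentiableAt_primeLogSeries_add_primeLogCubeSeries {s : ℂ} (hs : 1 / 2 < s.re) :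
    DifferentiableAt ℂ (fun s => primeLogSeries (2 * s) + primeLogCubeSeries s) s := by
  refine DifferentiableAt.add (DifferentiableAt.comp (f := fun s : ℂ => 2 * s) s
    (differentiableAt_primeLogSeries ?_) (by fun_prop))
    (differentiableAt_primeLogCubeSeries (by linarith))
  simp
  linarith

open MeasureTheory ProbabilityTheory Filter Topology Complex in
theorem not_forall_deriv_mul_complexMGF_eq {Ω : Type*} [MeasurableSpace Ω]
    {ν : Measure Ω} {Y : Ω → ℝ} (hY : ∀ᵐ ω ∂ν, Y ω ≤ 0)
    (hS : Set.Ioi 1 ⊆ integrableExpSet Y ν) {ε : ℝ} (hε : ε = 1 ∨ ε = -1) {e : ℂ → ℂ}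
    (he : Differentiable ℂ e) :
    ¬ ∀ s : ℂ, 1 < s.re →
      deriv (fun s => s * complexMGF Y ν s) s = ε * (primeLogSeries s - 1 / (s - 1)) - e s := by
  intro H
  refine not_forall_riemannZeta₁_mul_deriv_complexMGF_eq hY hS hε
    (h := fun s => ε * (primeLogSeries (2 * s) + primeLogCubeSeries s) + e s) ?_ ?_ ?_
  · exact fun s hs => (((differentiableAt_primeLogSeries_add_primeLogCubeSeries hs).const_mul
      _).add (he s)).differentiableWithinAt
  · intro γ
    have h : ContinuousAt (fun σ : ℝ => (σ : ℂ) * e (1 / 2 + γ * I + σ)) 0 :=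
      continuous_ofReal.continuousAt.mul (he.continuous.comp (by fun_prop)).continuousAt
    have h0 := h.tendsto.mono_left (nhdsWithin_le_nhds (s := Set.Ioi 0))
    rw [ofReal_zero, zero_mul] at h0
    have h1 := ((tendsto_mul_primeLogSeries_add_primeLogCubeSeries γ).const_mul (ε : ℂ)).add h0
    rw [add_zero] at h1
    convert h1 using 2
    · ring
    · split_ifs <;> ring
  · intro s hs
    have hz := riemannZeta₁_ne_zero_of_one_le_re hs.le
    have hld := logDeriv_riemannZeta₁_eq hs
    rw [div_eq_iff hz] at hld
    rw [H s hs, hld]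
    ring

open MeasureTheory in
/-- The measure on `(2, ∞)` with density `f`. -/
noncomputable def measureIoiTwo (f : ℝ → ℝ) : Measure ℝ :=
  (volume.restrict (Set.Ioi 2)).withDensity fun x => ENNReal.ofReal (f x)

open MeasureTheory in
theorem integral_measureIoiTwo {f : ℝ → ℝ} (hf : AEMeasurable f (volume.restrict (Set.Ioi 2)))
    (h0 : ∀ x > 2, 0 ≤ f x) (φ : ℝ → ℂ) :
    ∫ x, φ x ∂measureIoiTwo f = ∫ x in Set.Ioi 2, f x * φ x := by
  rw [measureIoiTwo, integral_withDensity_eq_integral_toReal_smul₀ hf.ennreal_ofReal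
    (ae_of_all _ fun _ => ENNReal.ofReal_lt_top)]
  refine setIntegral_congr_fun measurableSet_Ioi fun x hx => ?_
  simp only [ENNReal.toReal_ofReal (h0 x hx), Complex.real_smul]

open Complex in
theorem cexp_mul_neg_log {x : ℝ} (hx : 0 < x) (s : ℂ) :
    cexp (s * ((-Real.log x : ℝ) : ℂ)) = (x : ℂ) ^ (-s) := by
  rw [cpow_def_of_ne_zero (by exact_mod_cast hx.ne'), ← ofReal_log hx.le]
  congr 1
  push_cast
  ring

open MeasureTheory ProbabilityTheory in
theorem complexMGF_neg_log_measureIoiTwo {f : ℝ → ℝ}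
    (hf : AEMeasurable f (volume.restrict (Set.Ioi 2))) (h0 : ∀ x > 2, 0 ≤ f x) (s : ℂ) :
    complexMGF (fun x => -Real.log x) (measureIoiTwo f) s =
      ∫ x : ℝ in Set.Ioi 2, (f x : ℂ) * (x : ℂ) ^ (-s) := by
  rw [complexMGF, integral_measureIoiTwo hf h0]
  refine setIntegral_congr_fun measurableSet_Ioi fun x hx => ?_
  simp only [cexp_mul_neg_log (two_pos.trans (Set.mem_Ioi.1 hx))]

open MeasureTheory in
theorem integrableOn_mul_cpow_neg {f : ℝ → ℝ} {C : ℝ}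
    (hf : AEMeasurable f (volume.restrict (Set.Ioi 2))) (hC : ∀ x > 2, |f x| ≤ C)
    {s : ℂ} (hs : 1 < s.re) :
    IntegrableOn (fun x : ℝ => (f x : ℂ) * (x : ℂ) ^ (-s)) (Set.Ioi 2) := by
  refine Integrable.bdd_mul (c := C) (integrableOn_Ioi_cpow_of_lt (by simpa using hs) two_pos)
    (Complex.measurable_ofReal.comp_aemeasurable hf).aestronglyMeasurable ?_
  filter_upwards [ae_restrict_mem measurableSet_Ioi] with x hx
  rw [Complex.norm_real]
  exact hC x hx

open MeasureTheory ProbabilityTheory in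
theorem Ioi_one_subset_integrableExpSet_neg_log {f : ℝ → ℝ} {C : ℝ}
    (hf : AEMeasurable f (volume.restrict (Set.Ioi 2))) (hC : ∀ x > 2, |f x| ≤ C) :
    Set.Ioi 1 ⊆ integrableExpSet (fun x => -Real.log x) (measureIoiTwo f) := by
  intro a ha
  rw [integrableExpSet, Set.mem_ofPred_eq, measureIoiTwo,
    integrable_withDensity_iff_integrable_smul₀' hf.ennreal_ofReal
    (ae_of_all _ fun _ => ENNReal.ofReal_lt_top)]
  have h1 : IntegrableOn (fun x : ℝ => Real.exp (a * -Real.log x)) (Set.Ioi 2) := by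
    refine (integrableOn_Ioi_rpow_of_lt (a := -a) (by simpa using ha) two_pos).congr_fun
      (fun x hx => ?_) measurableSet_Ioi
    have hx0 : (0 : ℝ) < x := two_pos.trans hx
    simp only [Real.rpow_def_of_pos hx0]
    congr 1
    ring
  refine Integrable.bdd_mul (c := C) h1
    (hf.ennreal_ofReal.ennreal_toReal).aestronglyMeasurable ?_
  filter_upwards [ae_restrict_mem measurableSet_Ioi] with x hx
  have hC0 := (abs_nonneg _).trans (hC x hx)
  rw [Real.norm_of_nonneg ENNReal.toReal_nonneg]
  exact ENNReal.toReal_le_of_le_ofReal hC0 (ENNReal.ofReal_le_ofReal ((le_abs_self _).trans (hC x hx)))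

open MeasureTheory in
theorem ae_neg_log_nonpos_measureIoiTwo (f : ℝ → ℝ) :
    ∀ᵐ x ∂measureIoiTwo f, -Real.log x ≤ 0 := by
  refine (withDensity_absolutelyContinuous _ _).ae_le ?_
  filter_upwards [ae_restrict_mem measurableSet_Ioi] with x hx
  have hx2 : (2 : ℝ) < x := hx
  exact neg_nonpos.2 (Real.log_nonneg (by linarith))

theorem inv_log_le_two {x : ℝ} (hx : 2 ≤ x) : 0 ≤ 1 / Real.log x ∧ 1 / Real.log x ≤ 2 := by
  have h2 := Real.log_two_gt_d9
  have h3 : Real.log 2 ≤ Real.log x := Real.log_le_log two_pos hx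
  refine ⟨one_div_nonneg.2 (by linarith), ?_⟩
  rw [div_le_iff₀ (by linarith)]
  linarith

theorem continuousOn_one_div_log : ContinuousOn (fun t : ℝ => 1 / Real.log t) (Set.Ioi 1) := by
  refine continuousOn_const.div (Real.continuousOn_log.mono fun t ht => ?_) fun t ht => ?_
  · exact (zero_lt_one.trans (Set.mem_Ioi.1 ht)).ne'
  · exact (Real.log_pos ht).ne'

theorem hasDerivAt_Li {x : ℝ} (hx : 1 < x) : HasDerivAt Li (1 / Real.log x) x := by
  refine intervalIntegral.integral_hasDerivAt_right ?_ ?_ ?_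
  · refine (continuousOn_one_div_log.mono fun t ht => ?_).intervalIntegrable
    exact lt_of_lt_of_le (lt_min one_lt_two hx) ht.1
  · exact continuousOn_one_div_log.stronglyMeasurableAtFilter isOpen_Ioi x hx
  · exact continuousOn_one_div_log.continuousAt (Ioi_mem_nhds hx)

theorem abs_Li_le {x : ℝ} (hx : 2 ≤ x) : |Li x| ≤ 2 * x := by
  have h := intervalIntegral.norm_integral_le_of_norm_le_const (a := 2) (b := x) (C := 2)
    (f := fun t => 1 / Real.log t) fun t ht => by
      rw [Set.uIoc_of_le hx] at ht
      have := inv_log_le_two ht.1.le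
      rw [Real.norm_of_nonneg this.1]
      exact this.2
  rw [abs_of_nonneg (by linarith : 0 ≤ x - 2), Real.norm_eq_abs] at h
  exact h.trans (by linarith)

theorem primeCounting_eq_card (n : ℕ) :
    Nat.primeCounting n = ((Finset.Icc 1 n).filter Nat.Prime).card := by
  rw [← Nat.primesLE_card_eq_primeCounting, Nat.primesLE_eq_filter_Icc_one]

theorem primePi_le {x : ℝ} (hx : 0 ≤ x) : (primePi x : ℝ) ≤ x := by
  refine (Nat.cast_le.2 ?_).trans (Nat.floor_le hx)
  rw [primePi, primeCounting_eq_card]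
  exact (Finset.card_filter_le _ _).trans (by simp)

theorem measurable_primePi : Measurable fun x => (primePi x : ℝ) :=
  (measurable_from_top (f := fun n : ℕ => (Nat.primeCounting n : ℝ))).comp Nat.measurable_floor

open MeasureTheory in
theorem aemeasurable_Li : AEMeasurable Li (volume.restrict (Set.Ioi 2)) :=
  ContinuousOn.aemeasurable (fun _ hx => (hasDerivAt_Li
    (one_lt_two.trans (Set.mem_Ioi.1 hx))).continuousAt.continuousWithinAt) measurableSet_Ioi

open MeasureTheory in
theorem aemeasurable_one_div_log :
    AEMeasurable (fun t : ℝ => 1 / Real.log t) (volume.restrict (Set.Ioi 2)) :=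
  (measurable_const.div Real.measurable_log).aemeasurable

theorem div_mul_cpow_neg {x : ℝ} (hx : 0 < x) (y : ℝ) (s : ℂ) :
    ((y / x : ℝ) : ℂ) * (x : ℂ) ^ (-s) = y * (x : ℂ) ^ (-s - 1) := by
  have h : (x : ℂ) ≠ 0 := by exact_mod_cast hx.ne'
  rw [Complex.cpow_sub _ _ h, Complex.cpow_one]
  push_cast
  ring

theorem abs_div_le_of_abs_le_mul {C : ℝ} {f : ℝ → ℝ} (hf : ∀ x > 2, |f x| ≤ C * x) :
    ∀ x > 2, |f x / x| ≤ C := fun x hx => by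
  have hx0 : 0 < x := two_pos.trans hx
  rw [abs_div, abs_of_pos hx0, div_le_iff₀ hx0]
  exact hf x hx

open MeasureTheory Filter Topology in
theorem mul_integral_Li_div_mul_cpow_neg {s : ℂ} (hs : 1 < s.re) :
    s * ∫ x : ℝ in Set.Ioi 2, ((Li x / x : ℝ) : ℂ) * (x : ℂ) ^ (-s) =
      ∫ x : ℝ in Set.Ioi 2, ((1 / Real.log x : ℝ) : ℂ) * (x : ℂ) ^ (-s) := by
  have hLi : ∀ x > 2, |Li x| ≤ 2 * x := fun x hx => abs_Li_le (le_of_lt hx)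
  have hs0 : -s ≠ 0 := fun h => by simp [neg_eq_zero.1 h] at hs; linarith
  have hderiv : ∀ x ∈ Set.Ioi (2 : ℝ),
      HasDerivAt (fun x : ℝ => (x : ℂ) ^ (-s)) (-s * (x : ℂ) ^ (-s - 1)) x := fun x hx =>
    hasDerivAt_ofReal_cpow_const (two_pos.trans (Set.mem_Ioi.1 hx)).ne' hs0
  have hInt : IntegrableOn (fun x : ℝ => (Li x : ℂ) * (-s * (x : ℂ) ^ (-s - 1))) (Set.Ioi 2) := by
    refine IntegrableOn.congr_fun ((integrableOn_mul_cpow_neg (aemeasurable_Li.div aemeasurable_id)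
      (abs_div_le_of_abs_le_mul hLi) hs).const_mul (-s)) (fun x hx => ?_)
      measurableSet_Ioi
    simp only [Pi.div_apply, id]
    rw [div_mul_cpow_neg (two_pos.trans (Set.mem_Ioi.1 hx))]
    ring
  have hparts := integral_Ioi_mul_deriv_eq_deriv_mul (a := (2 : ℝ)) (a' := (0 : ℂ)) (b' := 0)
    (u := fun x : ℝ => (Li x : ℂ)) (u' := fun x : ℝ => ((1 / Real.log x : ℝ) : ℂ))
    (fun x hx => (hasDerivAt_Li (one_lt_two.trans (Set.mem_Ioi.1 hx))).ofReal_comp) hderiv hInt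
    (integrableOn_mul_cpow_neg aemeasurable_one_div_log (C := 2) (fun x hx => by
      rw [abs_of_nonneg (inv_log_le_two (le_of_lt hx)).1]
      exact (inv_log_le_two (le_of_lt hx)).2) hs) ?_ ?_
  · rw [sub_zero, zero_sub] at hparts
    rw [← neg_inj, ← hparts, ← neg_mul, ← integral_const_mul]
    refine setIntegral_congr_fun measurableSet_Ioi fun x hx => ?_
    rw [div_mul_cpow_neg (two_pos.trans (Set.mem_Ioi.1 hx))]
    ring
  · have hc : ContinuousAt (fun x : ℝ => (Li x : ℂ) * (x : ℂ) ^ (-s)) 2 :=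
      ((hasDerivAt_Li one_lt_two).ofReal_comp.continuousAt).mul
        (hasDerivAt_ofReal_cpow_const two_ne_zero hs0).continuousAt
    have h2 : Li 2 = 0 := intervalIntegral.integral_same
    have := hc.tendsto.mono_left (nhdsWithin_le_nhds (s := Set.Ioi 2))
    simp only [h2, Complex.ofReal_zero, zero_mul] at this
    exact this
  · rw [tendsto_zero_iff_norm_tendsto_zero]
    have h1 : Tendsto (fun x : ℝ => 2 * x ^ (-(s.re - 1))) atTop (𝓝 0) := by
      simpa using (tendsto_rpow_neg_atTop (sub_pos.2 hs)).const_mul 2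
    refine squeeze_zero' (Eventually.of_forall fun _ => norm_nonneg _) ?_ h1
    filter_upwards [eventually_gt_atTop 2] with x hx
    have hx0 : 0 < x := two_pos.trans hx
    rw [Pi.mul_apply, norm_mul, Complex.norm_real, Complex.norm_cpow_eq_rpow_re_of_pos hx0,
      neg_sub, sub_eq_add_neg, Real.rpow_add hx0, Real.rpow_one, ← mul_assoc, Complex.neg_re]
    gcongr
    exact hLi x hx

open MeasureTheory ProbabilityTheory in
theorem hasDerivAt_integral_one_div_log_mul_cpow_neg {s : ℂ} (hs : 1 < s.re) :
    HasDerivAt (fun s => ∫ x : ℝ in Set.Ioi 2, ((1 / Real.log x : ℝ) : ℂ) * (x : ℂ) ^ (-s))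
      (-(2 ^ (1 - s) / (s - 1))) s := by
  have h0 : ∀ x > 2, 0 ≤ 1 / Real.log x := fun x hx => (inv_log_le_two (le_of_lt hx)).1
  have hC : ∀ x > 2, |1 / Real.log x| ≤ 2 := fun x hx => by
    rw [abs_of_nonneg (h0 x hx)]
    exact (inv_log_le_two (le_of_lt hx)).2
  have hsub := Ioi_one_subset_integrableExpSet_neg_log aemeasurable_one_div_log hC
  have hd := hasDerivAt_complexMGF (interior_mono hsub (by rwa [interior_Ioi, Set.mem_Ioi]))
    (z := s)
  rw [funext (complexMGF_neg_log_measureIoiTwo aemeasurable_one_div_log h0)] at hd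
  convert hd using 1
  rw [integral_measureIoiTwo aemeasurable_one_div_log h0]
  have : ∫ x : ℝ in Set.Ioi 2, (x : ℂ) ^ (-s) = 2 ^ (1 - s) / (s - 1) := by
    rw [integral_Ioi_cpow_of_lt (by simpa using hs) two_pos, Complex.ofReal_ofNat, neg_add_eq_sub,
      ← neg_sub s 1, neg_div_neg_eq]
  rw [← this, ← integral_neg]
  refine setIntegral_congr_fun measurableSet_Ioi fun x hx => ?_
  have hx2 : (2 : ℝ) < x := hx
  have hlog : (Real.log x : ℂ) ≠ 0 := by exact_mod_cast (Real.log_pos (by linarith)).ne'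
  rw [cexp_mul_neg_log (by linarith)]
  push_cast
  field_simp

/-- The indicator function of the primes. -/
def primeIndicator (n : ℕ) : ℝ := if n.Prime then 1 else 0

theorem sum_primeIndicator (n : ℕ) :
    ∑ k ∈ Finset.Icc 1 n, primeIndicator k = Nat.primeCounting n := by
  simp [primeIndicator, primeCounting_eq_card]

open MeasureTheory in
theorem mul_integral_primePi_div_mul_cpow_neg {s : ℂ} (hs : 1 < s.re) :
    s * ∫ x : ℝ in Set.Ioi 2, ((primePi x / x : ℝ) : ℂ) * (x : ℂ) ^ (-s) =
      LSeries (fun n => primeIndicator n) s := by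
  have hO : (fun n => ∑ k ∈ Finset.Icc 1 n, primeIndicator k) =O[Filter.atTop]
      fun n => (n : ℝ) ^ (1 : ℝ) := by
    refine Asymptotics.IsBigO.of_bound 1 (Filter.Eventually.of_forall fun n => ?_)
    have := primePi_le (x := n) n.cast_nonneg
    rw [primePi, Nat.floor_natCast] at this
    simpa [sum_primeIndicator] using this
  rw [LSeries_eq_mul_integral_of_nonneg primeIndicator zero_le_one hs hO
    fun n => by unfold primeIndicator; split_ifs <;> norm_num]
  congr 1
  rw [← integral_Ici_eq_integral_Ioi]
  have hsub : Set.Ici (2 : ℝ) ⊆ Set.Ioi 1 := fun x (hx : 2 ≤ x) => one_lt_two.trans_le hx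
  rw [setIntegral_congr_fun measurableSet_Ioi
    (g := fun x : ℝ => (primePi x : ℂ) * (x : ℂ) ^ (-s - 1)),
    setIntegral_eq_of_subset_of_forall_sdiff_eq_zero measurableSet_Ioi hsub]
  · refine setIntegral_congr_fun measurableSet_Ici fun x hx => ?_
    simpa using div_mul_cpow_neg (two_pos.trans_le (Set.mem_Ici.1 hx)) (primePi x) s
  · intro x hx
    have h2 : x < 2 := not_le.1 hx.2
    have : ⌊x⌋₊ ≤ 1 := Nat.lt_succ_iff.1 ((Nat.floor_lt (zero_lt_one.trans hx.1).le).2 (by simpa))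
    simp [primePi, Nat.primeCounting_eq_zero_iff.2 this]
  · intro x _
    have := congrArg (fun y : ℝ => (y : ℂ)) (sum_primeIndicator ⌊x⌋₊)
    push_cast at this
    simp only [this, primePi]
    congr 2
    ring

theorem hasDerivAt_LSeries_primeIndicator {s : ℂ} (hs : 1 < s.re) :
    HasDerivAt (LSeries fun n => primeIndicator n) (-primeLogSeries s) s := by
  have habs : LSeries.abscissaOfAbsConv (fun n => (primeIndicator n : ℂ)) < s.re := by
    refine (LSeries.abscissaOfAbsConv_le_of_le_const ⟨1, fun n _ => ?_⟩).trans_lt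
      (by exact_mod_cast hs)
    unfold primeIndicator
    split_ifs <;> simp
  convert LSeries_hasDerivAt habs using 2
  rw [primeLogSeries, LSeries]
  refine (tsum_subtype {p : ℕ | p.Prime}
    (fun p : ℕ => (Real.log p : ℂ) * (p : ℂ) ^ (-s))).trans (tsum_congr fun n => ?_)
  by_cases hn : n.Prime
  · rw [Set.indicator_of_mem (show n ∈ {p : ℕ | p.Prime} from hn),
      LSeries.term_of_ne_zero hn.ne_zero]
    simp [LSeries.logMul, primeIndicator, hn, Complex.cpow_neg, div_eq_mul_inv]
  · rw [Set.indicator_of_notMem (show n ∉ {p : ℕ | p.Prime} from hn)]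
    simp [LSeries.term, LSeries.logMul, primeIndicator, hn]

open MeasureTheory in
theorem mul_integral_indicator_div_mul_cpow_neg {X : ℝ} (hX : 2 ≤ X) {s : ℂ} (hs : 1 < s.re) :
    s * ∫ x : ℝ in Set.Ioi 2, ((Set.indicator (Set.Iic X) 1 x / x : ℝ) : ℂ) * (x : ℂ) ^ (-s) =
      2 ^ (-s) - (X : ℂ) ^ (-s) := by
  have hs0 : s ≠ 0 := fun h => by simp [h] at hs; linarith
  have h1 : ∫ x : ℝ in Set.Ioi 2, ((Set.indicator (Set.Iic X) 1 x / x : ℝ) : ℂ) * (x : ℂ) ^ (-s) =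
      ∫ x : ℝ in Set.Ioi 2, Set.indicator (Set.Iic X) (fun x : ℝ => (x : ℂ) ^ (-s - 1)) x := by
    refine setIntegral_congr_fun measurableSet_Ioi fun x hx => ?_
    rw [div_mul_cpow_neg (two_pos.trans (Set.mem_Ioi.1 hx))]
    by_cases h : x ∈ Set.Iic X <;> simp [h]
  rw [h1, setIntegral_indicator measurableSet_Iic, Set.Ioi_inter_Iic,
    ← intervalIntegral.integral_of_le hX, integral_cpow, sub_add_cancel]
  · push_cast
    field_simp
    ring
  · refine Or.inr ⟨fun h => hs0 (by linear_combination -h), fun h => ?_⟩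
    rw [Set.uIcc_of_le hX] at h
    linarith [h.1]

open MeasureTheory ProbabilityTheory Filter Topology in
theorem not_forall_mul_Li_sub_primePi_nonneg {ε X : ℝ} (hε : ε = 1 ∨ ε = -1) (hX : 2 ≤ X) :
    ¬ ∀ x > X, 0 ≤ ε * (Li x - primePi x) := by
  intro H
  have hE : ∀ x > 2, |ε * (Li x - primePi x)| ≤ 3 * x := fun x hx => by
    have h1 := abs_Li_le (le_of_lt hx)
    have h2 := primePi_le (two_pos.trans hx).le
    have h3 : |ε| = 1 := by rcases hε with rfl | rfl <;> simp
    have h4 : (0 : ℝ) ≤ primePi x := Nat.cast_nonneg _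
    rw [abs_mul, h3, one_mul]
    refine (abs_sub _ _).trans ?_
    rw [abs_of_nonneg h4]
    linarith
  set K : ℝ := 3 * X
  set χ : ℝ → ℝ := Set.indicator (Set.Iic X) 1 with hχ
  have hχ01 : ∀ x, 0 ≤ χ x ∧ χ x ≤ 1 := fun x => by
    by_cases h : x ∈ Set.Iic X <;> simp [hχ, h]
  have mχ : Measurable χ := measurable_one.indicator measurableSet_Iic
  set g : ℝ → ℝ := fun x => ε * (Li x - primePi x) + K * χ x with hg
  have g0 : ∀ x > 2, 0 ≤ g x / x := fun x hx => by
    refine div_nonneg ?_ (two_pos.trans hx).le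
    by_cases h : x ∈ Set.Iic X
    · have h1 : χ x = 1 := by simp [hχ, h]
      have h2 := neg_le_of_abs_le (hE x hx)
      have h3 : x ≤ X := h
      simp only [hg, h1, K]
      linarith
    · have h1 : χ x = 0 := by simp [hχ, h]
      have h2 := H x (not_le.1 h)
      simp only [hg, h1]
      linarith
  have gC : ∀ x > 2, |g x / x| ≤ 3 + K := abs_div_le_of_abs_le_mul fun x hx => by
    refine (abs_add_le _ _).trans ?_
    have h1 : |K * χ x| ≤ K * x := by
      have hK : 0 ≤ K := by simp only [K]; linarith
      rw [abs_of_nonneg (mul_nonneg hK (hχ01 x).1)]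
      exact mul_le_mul_of_nonneg_left ((hχ01 x).2.trans (by linarith)) hK
    linarith [hE x hx]
  have mLi : AEMeasurable (fun x => Li x / x) (volume.restrict (Set.Ioi 2)) :=
    aemeasurable_Li.div aemeasurable_id
  have mPi : AEMeasurable (fun x => primePi x / x) (volume.restrict (Set.Ioi 2)) :=
    (measurable_primePi.div measurable_id).aemeasurable
  have mχx : AEMeasurable (fun x => χ x / x) (volume.restrict (Set.Ioi 2)) :=
    (mχ.div measurable_id).aemeasurable
  have mg : AEMeasurable (fun x => g x / x) (volume.restrict (Set.Ioi 2)) :=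
    (((aemeasurable_Li.sub measurable_primePi.aemeasurable).const_mul ε).add
      (mχ.aemeasurable.const_mul K)).div aemeasurable_id
  have hmgf : ∀ s : ℂ, 1 < s.re →
      s * complexMGF (fun x => -Real.log x) (measureIoiTwo fun x => g x / x) s =
        ε * ((∫ x : ℝ in Set.Ioi 2, ((1 / Real.log x : ℝ) : ℂ) * (x : ℂ) ^ (-s)) -
          LSeries (fun n => primeIndicator n) s) + K * (2 ^ (-s) - (X : ℂ) ^ (-s)) := by
    intro s hs
    have i1 := integrableOn_mul_cpow_neg mLi
      (abs_div_le_of_abs_le_mul fun x hx => abs_Li_le (le_of_lt hx)) hs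
    have i2 := integrableOn_mul_cpow_neg mPi (C := 1) (abs_div_le_of_abs_le_mul fun x hx => by
      rw [abs_of_nonneg (Nat.cast_nonneg _), one_mul]
      exact primePi_le (two_pos.trans hx).le) hs
    have i3 := integrableOn_mul_cpow_neg mχx (C := 1) (abs_div_le_of_abs_le_mul fun x hx => by
      rw [abs_of_nonneg (hχ01 x).1]
      linarith [(hχ01 x).2]) hs
    rw [complexMGF_neg_log_measureIoiTwo mg g0, ← mul_integral_Li_div_mul_cpow_neg hs,
      ← mul_integral_primePi_div_mul_cpow_neg hs, ← mul_integral_indicator_div_mul_cpow_neg hX hs,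
      ← mul_sub, mul_left_comm (ε : ℂ), mul_left_comm (K : ℂ), ← mul_add, ← integral_sub i1 i2,
      ← integral_const_mul (ε : ℂ),
      ← integral_const_mul (K : ℂ), ← integral_add]
    · congr 1
      refine setIntegral_congr_fun measurableSet_Ioi fun x _ => ?_
      simp only [hg]
      push_cast
      ring
    · exact (i1.sub i2).const_mul _
    · exact i3.const_mul _
  have hdiffpow : ∀ (c : ℂ), c ≠ 0 → ∀ s : ℂ,
      HasDerivAt (fun s : ℂ => c ^ (-s)) (-(Complex.log c * c ^ (-s))) s := fun c hc s => by
    simpa [mul_comm] using (hasDerivAt_neg s).const_cpow (c := c) (Or.inl hc)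
  have hX0 : (X : ℂ) ≠ 0 := by exact_mod_cast (two_pos.trans_le hX).ne'
  have hpow : Differentiable ℂ fun s : ℂ => (2 : ℂ) ^ (1 - s) := fun s =>
    (differentiableAt_id.const_sub 1).const_cpow (Or.inl two_ne_zero)
  refine not_forall_deriv_mul_complexMGF_eq
    (ae_neg_log_nonpos_measureIoiTwo fun x => g x / x)
    (Ioi_one_subset_integrableExpSet_neg_log mg gC) hε
    (e := fun s => ε * dslope (fun s : ℂ => (2 : ℂ) ^ (1 - s)) 1 s +
      K * (Complex.log 2 * 2 ^ (-s) - Complex.log X * (X : ℂ) ^ (-s))) ?_ ?_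
  · refine Differentiable.add (Differentiable.const_mul ?_ _) (Differentiable.const_mul
      (Differentiable.sub (Differentiable.const_mul ?_ _) (Differentiable.const_mul ?_ _)) _)
    · rw [← differentiableOn_univ] at hpow ⊢
      exact (Complex.differentiableOn_dslope univ_mem).2 hpow
    · exact fun s => (hdiffpow 2 two_ne_zero s).differentiableAt
    · exact fun s => (hdiffpow X hX0 s).differentiableAt
  · intro s hs
    have hs1 : s ≠ 1 := fun h => by simp [h] at hs
    have hopen : IsOpen {s : ℂ | 1 < s.re} := isOpen_lt continuous_const Complex.continuous_re
    have heq := Filter.eventuallyEq_of_mem (hopen.mem_nhds hs) hmgf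
    rw [heq.deriv_eq]
    have hd := (((hasDerivAt_integral_one_div_log_mul_cpow_neg hs).sub
      (hasDerivAt_LSeries_primeIndicator hs)).const_mul (ε : ℂ)).add
      (((hdiffpow 2 two_ne_zero s).sub (hdiffpow X hX0 s)).const_mul (K : ℂ))
    refine hd.deriv.trans ?_
    rw [dslope_of_ne _ hs1, slope_def_field, sub_self, Complex.cpow_zero]
    ring

/-- The difference `π(x) − Li(x)` changes sign infinitely often: beyond any bound `X` there
are points `x` where `π(x) > Li(x)` and points `y` where `π(y) < Li(y)`. -/
theorem primePi_sub_Li_changes_sign :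
    ∀ X : ℝ, ∃ x : ℝ, ∃ y : ℝ, X < x ∧ X < y ∧
      (primePi x : ℝ) > Li x ∧ (primePi y : ℝ) < Li y := by
  intro X
  have h1 := not_forall_mul_Li_sub_primePi_nonneg (X := max X 2) (Or.inl rfl) (le_max_right _ _)
  have h2 := not_forall_mul_Li_sub_primePi_nonneg (X := max X 2) (Or.inr rfl) (le_max_right _ _)
  push Not at h1 h2
  obtain ⟨x, hx, hx'⟩ := h1
  obtain ⟨y, hy, hy'⟩ := h2
  exact ⟨x, y, (le_max_left _ _).trans_lt hx, (le_max_left _ _).trans_lt hy, by linarith,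
    by linarith⟩
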